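/- arXiv:1808.04001 — 4 statements merged into one kernel-verified Lean document; each statement's English description precedes it below -/
import Mathlib

section
/- Let p be an odd prime and q a power of p. Let m, k ≥ 0 and d ≥ 1 be integers with k ≠ d + m. Let M be a monic polynomial of degree m and a a monic polynomial of degree k with gcd(a, M) = 1. For g a monic polynomial of degree d, set D = M²·g′ + a′·M − a·M′ (where ′ denotes the derivative with respect to T), E = rad(D)/gcd(M, rad(D)), and E₁ = rad₁(D)/gcd(M, rad₁(D)). Then there exist S ∈ {0, 1, −1}, w ∈ F_q[T], and a real Dirichlet character χ mod E with conductor E₁, all depending only on (d, a, M, g′) — that is, the same S, w, χ serve every monic g̃ of degree d with g̃′ = g′ — such that μ(a + gM) = S·χ(w + g), and S = 0 if and only if D = 0. -/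
open scoped Classical
open Polynomial Filter

/-- The Möbius function of a polynomial: `0` unless `f` is squarefree (in particular `μ 0 = 0`),
and `(-1)^k` for squarefree `f` with `k` distinct monic irreducible factors. -/
noncomputable def pmu {Fq : Type} [Field Fq] (f : Polynomial Fq) : ℤ :=
  if Squarefree f then (-1 : ℤ) ^ Multiset.card (UniqueFactorizationMonoid.normalizedFactors f)
  else 0

/-- The radical of a polynomial: the product of its distinct monic irreducible factors. -/
noncomputable def rad {Fq : Type} [Field Fq] (D : Polynomial Fq) : Polynomial Fq :=
  (UniqueFactorizationMonoid.normalizedFactors D).toFinset.prod id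

/-- The odd-part radical: the product of the monic irreducible factors appearing with odd
multiplicity. -/
noncomputable def rad1 {Fq : Type} [Field Fq] (D : Polynomial Fq) : Polynomial Fq :=
  ∏ P ∈ (UniqueFactorizationMonoid.normalizedFactors D).toFinset,
    if Odd ((UniqueFactorizationMonoid.normalizedFactors D).count P) then P else 1

section Aux12

lemma rs_deg {F : Type} [Field F] (f h : F[X]) (hf : f.Monic) (n : ℕ) (hn : h.natDegree ≤ n) :
    resultant f h f.natDegree n = resultant f h := by
  obtain ⟨c, rfl⟩ := Nat.exists_eq_add_of_le hn
  rw [resultant_add_right_deg _ _ _ _ _ le_rfl]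
  simp [hf.leadingCoeff]

lemma rs_mul_right {F : Type} [Field F] (f h₁ h₂ : F[X]) (hf : f.Monic) :
    resultant f (h₁ * h₂) = resultant f h₁ * resultant f h₂ := by
  rw [← resultant_mul_right f h₁ h₂ _ le_rfl, rs_deg _ _ hf _ natDegree_mul_le]

lemma rs_mul_left {F : Type} [Field F] (f₁ f₂ h : F[X]) (hf₁ : f₁.Monic) (hf₂ : f₂.Monic) :
    resultant (f₁ * f₂) h = resultant f₁ h * resultant f₂ h := by
  rw [← resultant_mul_left f₁ f₂ h _ le_rfl, hf₁.natDegree_mul hf₂]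

lemma rs_add_mul {F : Type} [Field F] (f h u : F[X]) (hf : f.Monic) :
    resultant f (h + f * u) = resultant f h := by
  let N := max (h.natDegree) (u.natDegree + f.natDegree)
  have h1 : (h + f * u).natDegree ≤ N := by
    refine (natDegree_add_le _ _).trans (max_le_max le_rfl ?_)
    rw [add_comm]; exact natDegree_mul_le
  rw [← rs_deg f (h + f * u) hf N h1, ← rs_deg f h hf N (le_max_left _ _),
    resultant_add_mul_right _ _ _ _ _ (le_max_right _ _) le_rfl]

lemma rs_congr {F : Type} [Field F] (f h h' : F[X]) (hf : f.Monic) (hd : f ∣ h - h') :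
    resultant f h = resultant f h' := by
  obtain ⟨u, hu⟩ := hd
  rw [show h = h' + f * u by rw [← hu]; ring, rs_add_mul _ _ _ hf]

lemma rs_one_right {F : Type} [Field F] (f : F[X]) :
    resultant f 1 = 1 := by simp

lemma rs_eq_zero {F : Type} [Field F] (f h : F[X]) (hf : f.Monic) :
    resultant f h = 0 ↔ ¬ IsCoprime f h := by
  rw [resultant_eq_zero_iff]; simp [hf.ne_zero]

lemma vand_frob {K : Type} [CommRing K] (φ : K →+* K) (n : ℕ) (v : Fin n → K)
    (h : ∀ i, φ (v i) = v (finRotate n i)) :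
    φ (Matrix.det (Matrix.vandermonde v)) = (-1) ^ (n - 1) * Matrix.det (Matrix.vandermonde v) := by
  have h1 : φ.mapMatrix (Matrix.vandermonde v) =
      (Matrix.vandermonde v).submatrix (finRotate n) id := by
    ext i j
    simp [Matrix.vandermonde_apply, h]
  rw [RingHom.map_det, h1, Matrix.det_permute, sign_finRotate]
  simp

lemma rs_eq_norm {F : Type} [Field F] [Fintype F] (P h : F[X]) (hP : P.Monic)
    (hirr : Irreducible P) :
    resultant P h = Algebra.norm F (AdjoinRoot.mk P h) := by
  have : Fact (Irreducible P) := ⟨hirr⟩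
  let pb := AdjoinRoot.powerBasis hP.ne_zero
  have : FiniteDimensional F (AdjoinRoot P) := pb.finite
  let E := AlgebraicClosure (AdjoinRoot P)
  apply (algebraMap F E).injective
  rw [Algebra.norm_eq_prod_embeddings F E]
  have hmin : minpoly F pb.gen = P := by
    rw [AdjoinRoot.powerBasis_gen, AdjoinRoot.minpoly_root hP.ne_zero, hP.leadingCoeff]; simp
  have h1 := resultant_eq_prod_eval (P.map (algebraMap F E)) (h.map (algebraMap F E))
    h.natDegree (natDegree_map_le) (IsAlgClosed.splits _)
  rw [natDegree_map, resultant_map_map] at h1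
  rw [h1, (hP.map _).leadingCoeff, one_pow, one_mul]
  have hnd : (P.map (algebraMap F E)).roots.Nodup :=
    nodup_roots ((PerfectField.separable_of_irreducible hirr).map)
  rw [Fintype.prod_equiv pb.liftEquiv' (fun σ : AdjoinRoot P →ₐ[F] E => σ (AdjoinRoot.mk P h))
    (fun y => aeval (y : E) h)]
  · rw [Finset.prod_mem_multiset _ _ (fun y : E => aeval y h) (fun x => rfl), hmin,
      Finset.prod_eq_multiset_prod, Multiset.toFinset_val, Multiset.dedup_eq_self.mpr hnd]
    simp
  · intro σ
    rw [PowerBasis.liftEquiv'_apply_coe, AdjoinRoot.powerBasis_gen, ← AdjoinRoot.aeval_eq,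
      aeval_algHom_apply]

lemma stick {F : Type} [Field F] [Fintype F] (h2 : ringChar F ≠ 2) (P : F[X]) (hP : P.Monic)
    (hirr : Irreducible P) :
    quadraticChar F ((-1) ^ (P.natDegree * (P.natDegree - 1) / 2) * resultant P (derivative P))
      = (-1) ^ (P.natDegree - 1) := by
  have : Fact (Irreducible P) := ⟨hirr⟩
  let pb := AdjoinRoot.powerBasis hP.ne_zero
  have : FiniteDimensional F (AdjoinRoot P) := pb.finite
  have : Finite (AdjoinRoot P) := Module.finite_of_finite F
  let : Fintype (AdjoinRoot P) := Fintype.ofFinite _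
  let K := AdjoinRoot P
  have hmin : minpoly F pb.gen = P := by
    rw [AdjoinRoot.powerBasis_gen, AdjoinRoot.minpoly_root hP.ne_zero, hP.leadingCoeff]; simp
  have hdim : pb.dim = P.natDegree := AdjoinRoot.powerBasis_dim _
  have hfr : Module.finrank F K = pb.dim := pb.finrank
  let E := AlgebraicClosure K
  let e : Fin pb.dim ≃ (K →ₐ[F] E) := ((finCongr hfr.symm).trans
    (Equiv.ofBijective _ (FiniteField.bijective_frobeniusAlgEquivOfAlgebraic_pow F K))).trans
    (Normal.algHomEquivAut F E K).symm
  have hn : 1 ≤ P.natDegree := hirr.natDegree_pos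
  have hnorm := Algebra.discr_powerBasis_eq_norm F pb
  have hprod := Algebra.discr_powerBasis_eq_prod F E pb e
  obtain ⟨δ, hδe⟩ : ∃ δ, δ = Algebra.discr F pb.basis := ⟨_, rfl⟩
  rw [← hδe] at hprod hnorm
  rw [hmin, hfr, hdim, AdjoinRoot.powerBasis_gen, AdjoinRoot.aeval_eq,
    ← rs_eq_norm P _ hP hirr] at hnorm
  rw [← hnorm]
  let v : Fin pb.dim → E := fun i => e i pb.gen
  have hv : ∀ i, v i = algebraMap K E pb.gen ^ (Fintype.card F ^ (i : ℕ)) := by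
    intro i
    simp only [v, e, Equiv.trans_apply, Equiv.ofBijective_apply]
    rw [Normal.algHomEquivAut_symm_apply]
    rw [AlgHom.comp_apply]
    have : ((FiniteField.frobeniusAlgEquivOfAlgebraic F K ^ (i : ℕ)) pb.gen : K)
        = pb.gen ^ (Fintype.card F ^ (i : ℕ)) := by
      rw [AlgEquiv.coe_pow, FiniteField.coe_frobeniusAlgEquivOfAlgebraic_iterate]
    rw [← map_pow, ← this]
    rfl
  have hcard : Fintype.card K = Fintype.card F ^ pb.dim := by
    rw [Module.card_eq_pow_finrank (K := F) (V := K), hfr]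
  let V := Matrix.det (Matrix.vandermonde v)
  have hV2 : algebraMap F E δ = V ^ 2 := by
    rw [hprod]; simp only [V]; rw [Matrix.det_vandermonde, ← Finset.prod_pow]
    refine Finset.prod_congr rfl fun i _ => ?_
    rw [← Finset.prod_pow]
  have hV0 : V ≠ 0 := by
    intro h0
    rw [Matrix.det_vandermonde_eq_zero_iff] at h0
    obtain ⟨i, j, hij, hne⟩ := h0
    exact hne (e.injective (pb.algHom_ext hij))
  have hrot : ∀ i, (FiniteField.frobeniusAlgHom F E : E →+* E) (v i) = v (finRotate pb.dim i) := by
    intro i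
    have : (FiniteField.frobeniusAlgHom F E : E →+* E) (v i) = v i ^ Fintype.card F := rfl
    rw [this, hv, hv, ← pow_mul, ← pow_succ]
    have hgen : algebraMap K E pb.gen ^ (Fintype.card F ^ pb.dim) = algebraMap K E pb.gen := by
      rw [← hcard, ← map_pow]; congr 1; exact FiniteField.pow_card (K := K) _
    clear hδe hprod
    clear_value v e
    generalize pb.dim = n at *
    cases n with
    | zero => exact i.elim0
    | succ n =>
      by_cases hi : i = Fin.last n
      · subst hi; simp [hgen]
      · have hi' : (i : ℕ) < n := by
          have := i.2
          have h3 : (i : ℕ) ≠ n := fun h => hi (Fin.ext h)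
          omega
        rw [finRotate_apply, Fin.val_add_one_of_lt (Fin.lt_last_iff_ne_last.mpr hi)]
  have hVq := vand_frob _ _ v hrot
  have hVq' : V ^ Fintype.card F = (-1) ^ (P.natDegree - 1) * V := by
    rw [← hdim]; exact hVq
  have hodd : Fintype.card F = 2 * (Fintype.card F / 2) + 1 := by
    have := FiniteField.odd_card_of_char_ne_two h2
    omega
  have hVq1 : V ^ (2 * (Fintype.card F / 2)) = (-1) ^ (P.natDegree - 1) := by
    rw [hodd, pow_succ] at hVq'
    have := mul_right_cancel₀ hV0 hVq'
    convert this using 3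
  have hδ : ((quadraticChar F δ : ℤ) : F) = ((-1 : ℤ) ^ (P.natDegree - 1) : ℤ) := by
    rw [quadraticChar_eq_pow_of_char_ne_two' h2]
    apply (algebraMap F E).injective
    rw [map_pow, hV2, ← pow_mul, hVq1]
    simp
  have hδ0 : δ ≠ 0 := by
    intro h0
    rw [h0, map_zero] at hV2
    exact hV0 (pow_eq_zero_iff (by norm_num) |>.mp hV2.symm)
  have hne : (1 : F) ≠ -1 := by
    have := Ring.neg_one_ne_one_of_char_ne_two h2
    exact this.symm
  rcases quadraticChar_dichotomy hδ0 with h | h <;>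
    rcases neg_one_pow_eq_or ℤ (P.natDegree - 1) with h' | h' <;>
    rw [h, h'] at hδ <;> rw [h, h'] <;> simp at hδ
  · exact absurd hδ hne
  · exact absurd hδ hne.symm

lemma choose_add_two (a b : ℕ) :
    (a + b).choose 2 = a.choose 2 + b.choose 2 + a * b := by
  induction b with
  | zero => simp
  | succ b ih =>
    rw [← add_assoc, Nat.choose_succ_succ' (a + b) 1, ih, Nat.choose_succ_succ' b 1]
    simp; ring

lemma qc_unit {F : Type} [Field F] [Fintype F] {x : F} (hx : x ≠ 0) :
    IsUnit (quadraticChar F x) := by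
  rcases quadraticChar_dichotomy hx with h | h <;> rw [h] <;> simp

lemma qc_sq {F : Type} [Field F] [Fintype F] {x : F} (hx : x ≠ 0) :
    quadraticChar F x * quadraticChar F x = 1 := by
  have := quadraticChar_sq_one hx
  rwa [pow_two] at this

lemma pellet_multiset {F : Type} [Field F] [Fintype F] (h2 : ringChar F ≠ 2)
    (s : Multiset F[X]) (hs : ∀ P ∈ s, P.Monic ∧ Irreducible P) (hsq : Squarefree s.prod) :
    quadraticChar F ((-1) ^ (s.prod.natDegree.choose 2) * resultant s.prod (derivative s.prod))
      = (-1) ^ s.prod.natDegree * (-1) ^ Multiset.card s := by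
  induction s using Multiset.induction_on with
  | empty => simp
  | cons P s ih =>
    obtain ⟨hP, hirr⟩ := hs P (Multiset.mem_cons_self _ _)
    have hs' : ∀ Q ∈ s, Q.Monic ∧ Irreducible Q := fun Q hQ => hs Q (Multiset.mem_cons_of_mem hQ)
    rw [Multiset.prod_cons] at hsq ⊢
    have hh : s.prod.Monic := by
      simpa using monic_multiset_prod_of_monic s id (fun Q hQ => (hs' Q hQ).1)
    have ih := ih hs' (hsq.squarefree_of_dvd (Dvd.intro_left _ rfl))
    have hcop : IsCoprime P s.prod := by
      rw [hirr.coprime_iff_not_dvd]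
      rintro ⟨c, hc⟩
      apply hirr.not_isUnit
      apply hsq
      rw [hc]
      exact ⟨c, by ring⟩
    have hst := stick h2 P hP hirr
    rw [← Nat.choose_two_right] at hst
    generalize s.prod = h at *
    have r1 : resultant P (derivative P * h + P * derivative h) =
        resultant P h * resultant P (derivative P) := by
      rw [rs_add_mul _ _ _ hP, rs_mul_right _ _ _ hP, mul_comm]
    have r2 : resultant h (derivative P * h + P * derivative h) =
        (-1) ^ (h.natDegree * P.natDegree) * resultant P h * resultant h (derivative h) := by
      rw [add_comm, mul_comm (derivative P) h, rs_add_mul _ _ _ hh, rs_mul_right _ _ _ hh,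
        resultant_comm h P]
    rw [derivative_mul, rs_mul_left _ _ _ hP hh, r1, r2, hP.natDegree_mul hh, choose_add_two]
    have hne : resultant P h ≠ 0 := by rw [Ne, rs_eq_zero _ _ hP]; simpa using hcop
    have hn : 1 ≤ P.natDegree := hirr.natDegree_pos
    have hneg : ((-1 : F) ^ (P.natDegree * h.natDegree)) ≠ 0 := by simp
    have e1 : (-1 : F) ^ (P.natDegree.choose 2 + h.natDegree.choose 2 + P.natDegree * h.natDegree) *
        (resultant P h * resultant P (derivative P) *
          ((-1) ^ (h.natDegree * P.natDegree) * resultant P h * resultant h (derivative h)))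
        = (((-1) ^ P.natDegree.choose 2) * resultant P (derivative P)) *
          (((-1) ^ h.natDegree.choose 2) * resultant h (derivative h)) *
          ((-1) ^ (P.natDegree * h.natDegree) * resultant P h) ^ 2 := by
      rw [mul_comm h.natDegree]
      ring
    rw [e1, map_mul, map_mul, hst, ih, map_pow, quadraticChar_sq_one (mul_ne_zero hneg hne)]
    obtain ⟨n, hn'⟩ := Nat.exists_eq_add_of_le' hn
    rw [hn']
    simp only [Nat.add_sub_cancel, Multiset.card_cons]
    ring

lemma nf_monic {F : Type} [Field F] (D P : F[X])
    (hP : P ∈ UniqueFactorizationMonoid.normalizedFactors D) : P.Monic ∧ Irreducible P := by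
  refine ⟨?_, UniqueFactorizationMonoid.irreducible_of_normalized_factor _ hP⟩
  have h1 := UniqueFactorizationMonoid.normalize_normalized_factor _ hP
  rw [← h1]
  exact monic_normalize (UniqueFactorizationMonoid.irreducible_of_normalized_factor _ hP).ne_zero

lemma pellet {F : Type} [Field F] [Fintype F] (h2 : ringChar F ≠ 2) (f : F[X]) (hf : f.Monic) :
    pmu f = (-1) ^ f.natDegree *
      quadraticChar F ((-1) ^ (f.natDegree.choose 2) * resultant f (derivative f)) := by
  unfold pmu
  split_ifs with hsq
  · have hprod : (UniqueFactorizationMonoid.normalizedFactors f).prod = f := by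
      rw [UniqueFactorizationMonoid.prod_normalizedFactors_eq hf.ne_zero, hf.normalize_eq_self]
    have := pellet_multiset h2 (UniqueFactorizationMonoid.normalizedFactors f)
      (fun P hP => nf_monic f P hP) (by rwa [hprod])
    rw [hprod] at this
    rw [this, ← mul_assoc, ← mul_pow]
    simp
  · rw [← PerfectField.separable_iff_squarefree] at hsq
    rw [(rs_eq_zero f _ hf).mpr hsq]
    simp

lemma qc_rs_D {F : Type} [Field F] [Fintype F] (D : F[X]) (hD : D ≠ 0) (N : ℕ) :
    ∃ c : ℤ, IsUnit c ∧ ∀ f : F[X], f.Monic → f.natDegree = N →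
      quadraticChar F (resultant f D) = c *
        ∏ P ∈ (UniqueFactorizationMonoid.normalizedFactors D).toFinset,
          quadraticChar F (resultant P f) ^
            (UniqueFactorizationMonoid.normalizedFactors D).count P := by
  set s := UniqueFactorizationMonoid.normalizedFactors D with hs
  obtain ⟨u, hu⟩ : ∃ u : F, u ≠ 0 ∧ D = C u * s.prod := by
    refine ⟨D.leadingCoeff, by simpa using hD, ?_⟩
    rw [hs, UniqueFactorizationMonoid.prod_normalizedFactors_eq hD, normalize_apply]
    rw [mul_comm, mul_assoc]
    rw [coe_normUnit_of_ne_zero hD, ← C_mul, inv_mul_cancel₀ (by simpa using hD), C_1, mul_one]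
  refine ⟨quadraticChar F (u ^ N) * (s.map fun P => quadraticChar F ((-1) ^ (N * P.natDegree))).prod,
    ?_, ?_⟩
  · refine (qc_unit (pow_ne_zero _ hu.1)).mul ?_
    clear hu hs
    induction s using Multiset.induction_on with
    | empty => simp
    | cons P s ih =>
      rw [Multiset.map_cons, Multiset.prod_cons]
      exact (qc_unit (by simp)).mul ih
  · intro f hf hfN
    rw [← Finset.prod_multiset_map_count s (fun P => quadraticChar F (resultant P f)), hu.2,
      rs_mul_right _ _ _ hf, map_mul]
    have hC : resultant f (C u) = u ^ N := by simp [hfN]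
    rw [hC, mul_assoc]
    congr 1
    clear hu hs
    induction s using Multiset.induction_on with
    | empty => simp
    | cons P s ih =>
      rw [Multiset.prod_cons, Multiset.map_cons, Multiset.prod_cons, Multiset.map_cons,
        Multiset.prod_cons, rs_mul_right _ _ _ hf, map_mul, ih, resultant_comm f P, map_mul, hfN]
      ring


lemma isUnit_mk_iff {F : Type} [Field F] (E x : F[X]) :
    IsUnit (Ideal.Quotient.mk (Ideal.span {E}) x) ↔ IsCoprime x E := by
  constructor
  · intro h
    obtain ⟨y, hy⟩ := h.exists_right_inv
    obtain ⟨y, rfl⟩ := Ideal.Quotient.mk_surjective y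
    rw [← map_mul, ← map_one (Ideal.Quotient.mk (Ideal.span {E})), Ideal.Quotient.eq,
      Ideal.mem_span_singleton] at hy
    obtain ⟨c, hc⟩ := hy
    exact ⟨y, -c, by linear_combination hc⟩
  · rintro ⟨u, v, h⟩
    refine IsUnit.of_mul_eq_one (Ideal.Quotient.mk (Ideal.span {E}) u) ?_
    rw [← map_mul, ← map_one (Ideal.Quotient.mk (Ideal.span {E})), Ideal.Quotient.eq,
      Ideal.mem_span_singleton]
    exact ⟨-v, by linear_combination h⟩

lemma mkChar {F : Type} [Field F] (E : F[X]) (ψ : F[X] → ℂ) (h1 : ψ 1 = 1)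
    (hmul : ∀ x y, ψ (x * y) = ψ x * ψ y) (hcongr : ∀ x y, E ∣ x - y → ψ x = ψ y)
    (hnon : ∀ x, ¬ IsCoprime x E → ψ x = 0) :
    ∃ χ : MulChar (F[X] ⧸ Ideal.span {E}) ℂ, ∀ x, χ (Ideal.Quotient.mk _ x) = ψ x := by
  let r : F[X] ⧸ Ideal.span {E} → F[X] :=
    Function.surjInv (Ideal.Quotient.mk_surjective (I := Ideal.span {E}))
  have hr : ∀ z, Ideal.Quotient.mk (Ideal.span {E}) (r z) = z := Function.surjInv_eq _
  have key : ∀ z x, Ideal.Quotient.mk (Ideal.span {E}) x = z → ψ (r z) = ψ x := by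
    intro z x h
    apply hcongr
    rw [← Ideal.mem_span_singleton, ← Ideal.Quotient.eq, hr, h]
  refine ⟨{ toFun := fun z => ψ (r z), map_one' := ?_, map_mul' := ?_, map_nonunit' := ?_ }, ?_⟩
  · rw [key 1 1 (map_one _), h1]
  · intro y z
    rw [← hmul]
    exact key _ _ (by rw [map_mul, hr, hr])
  · intro z hz
    apply hnon
    rw [← isUnit_mk_iff, hr]
    exact hz
  · intro x
    exact key _ _ rfl

lemma charOf {F : Type} [Field F] [Fintype F] (A : Finset F[X]) (v : F[X] → ℕ)
    (hA : ∀ P ∈ A, P.Monic ∧ Irreducible P) (hv : ∀ P ∈ A, v P ≠ 0) (E : F[X])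
    (hE : Associated E (∏ P ∈ A, P)) :
    ∃ χ : MulChar (F[X] ⧸ Ideal.span {E}) ℂ, ∀ x, χ (Ideal.Quotient.mk _ x) =
      ((∏ P ∈ A, quadraticChar F (resultant P x) ^ v P : ℤ) : ℂ) := by
  apply mkChar
  · simp
  · intro x y
    rw [← Int.cast_mul, ← Finset.prod_mul_distrib]
    congr 1
    refine Finset.prod_congr rfl fun P hP => ?_
    rw [rs_mul_right _ _ _ (hA P hP).1, map_mul, mul_pow]
  · intro x y hxy
    congr 1
    refine Finset.prod_congr rfl fun P hP => ?_
    rw [rs_congr P x y (hA P hP).1]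
    exact ((Finset.dvd_prod_of_mem _ hP).trans hE.symm.dvd).trans hxy
  · intro x hx
    have : ∃ P ∈ A, ¬ IsCoprime x P := by
      by_contra! hc
      apply hx
      have h1 : IsCoprime x (∏ P ∈ A, P) := IsCoprime.prod_right hc
      exact h1.of_isCoprime_of_dvd_right hE.dvd
    obtain ⟨P, hP, hxP⟩ := this
    rw [Finset.prod_eq_zero hP]
    · simp
    · rw [(rs_eq_zero P x (hA P hP).1).mpr (fun h => hxP h.symm)]
      simp [hv P hP]

lemma pairwise_cop {F : Type} [Field F] (A : Finset F[X])
    (hA : ∀ P ∈ A, P.Monic ∧ Irreducible P) (P Q : F[X]) (hP : P ∈ A) (hQ : Q ∈ A) (hne : P ≠ Q) :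
    IsCoprime P Q := by
  rw [(hA P hP).2.coprime_iff_not_dvd]
  intro h
  exact hne (eq_of_monic_of_associated (hA P hP).1 (hA Q hQ).1
    ((hA P hP).2.associated_of_dvd (hA Q hQ).2 h))

lemma prod_dvd_of {F : Type} [Field F] (A : Finset F[X])
    (hA : ∀ P ∈ A, P.Monic ∧ Irreducible P) (M : F[X]) (h : ∀ P ∈ A, P ∣ M) :
    (∏ P ∈ A, P) ∣ M := by
  refine Finset.prod_dvd_of_coprime ?_ h
  intro P hP Q hQ hne
  exact pairwise_cop A hA P Q hP hQ hne

lemma div_gcd {F : Type} [Field F] (A : Finset F[X])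
    (hA : ∀ P ∈ A, P.Monic ∧ Irreducible P) (M : F[X]) :
    Associated ((∏ P ∈ A, P) / gcd M (∏ P ∈ A, P)) (∏ P ∈ A with ¬ P ∣ M, P) := by
  set R := ∏ P ∈ A, P with hR
  have hR0 : R ≠ 0 := Finset.prod_ne_zero_iff.mpr fun P hP => (hA P hP).1.ne_zero
  have hsplit : (∏ P ∈ A with P ∣ M, P) * (∏ P ∈ A with ¬ P ∣ M, P) = R :=
    Finset.prod_filter_mul_prod_filter_not A _ _
  set B := ∏ P ∈ A with P ∣ M, P with hB
  set A' := ∏ P ∈ A with ¬ P ∣ M, P with hA'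
  have hg : Associated (gcd M R) B := by
    apply associated_of_dvd_dvd
    · have hc : IsCoprime M A' := by
        refine IsCoprime.prod_right fun P hP => ?_
        rw [Finset.mem_filter] at hP
        exact ((hA P hP.1).2.coprime_iff_not_dvd.mpr hP.2).symm
      have hc' : IsCoprime (gcd M R) A' := hc.of_isCoprime_of_dvd_left (gcd_dvd_left _ _)
      refine hc'.dvd_of_dvd_mul_right ?_
      rw [hsplit]
      exact gcd_dvd_right _ _
    · apply dvd_gcd
      · exact prod_dvd_of _ (fun P hP => hA P (Finset.mem_filter.mp hP).1) M
          (fun P hP => (Finset.mem_filter.mp hP).2)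
      · exact ⟨_, hsplit.symm⟩
  have hg0 : gcd M R ≠ 0 := fun h => hR0 (by simpa [h] using gcd_dvd_right M R)
  have h3 : gcd M R * (R / gcd M R) = R :=
    EuclideanDomain.mul_div_cancel' hg0 (gcd_dvd_right _ _)
  have h4 : Associated (gcd M R * (R / gcd M R)) (B * A') := by rw [h3, hsplit]
  exact h4.of_mul_left hg hg0

lemma exists_rs_neg {F : Type} [Field F] [Fintype F] (h2 : ringChar F ≠ 2) (P : F[X])
    (hP : P.Monic) (hirr : Irreducible P) :
    ∃ y, quadraticChar F (resultant P y) = -1 := by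
  have : Fact (Irreducible P) := ⟨hirr⟩
  let pb := AdjoinRoot.powerBasis hP.ne_zero
  have : FiniteDimensional F (AdjoinRoot P) := pb.finite
  have : Finite (AdjoinRoot P) := Module.finite_of_finite F
  obtain ⟨c, hc⟩ := quadraticChar_exists_neg_one h2
  obtain ⟨z, hz⟩ := FiniteField.norm_surjective F (AdjoinRoot P) c
  obtain ⟨y, rfl⟩ := AdjoinRoot.mk_surjective z
  exact ⟨y, by rw [rs_eq_norm P y hP hirr, hz, hc]⟩

lemma conductor_min {F : Type} [Field F] [Fintype F] (h2 : ringChar F ≠ 2)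
    (A : Finset F[X]) (v : F[X] → ℕ)
    (hA : ∀ P ∈ A, P.Monic ∧ Irreducible P) (E : F[X])
    (hE : Associated E (∏ P ∈ A, P)) (χ : MulChar (F[X] ⧸ Ideal.span {E}) ℂ)
    (hχ : ∀ x, χ (Ideal.Quotient.mk _ x) =
      ((∏ P ∈ A, quadraticChar F (resultant P x) ^ v P : ℤ) : ℂ))
    (L : F[X]) (hL : L ∣ E) (χ₁ : MulChar (F[X] ⧸ Ideal.span {L}) ℂ)
    (hχ₁ : ∀ x : F[X], IsUnit (Ideal.Quotient.mk (Ideal.span {E}) x) →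
          χ (Ideal.Quotient.mk (Ideal.span {E}) x)
            = χ₁ (Ideal.Quotient.mk (Ideal.span {L}) x)) :
    (∏ P ∈ A with Odd (v P), P) ∣ L := by
  refine prod_dvd_of _ (fun P hP => hA P (Finset.mem_filter.mp hP).1) L ?_
  intro P hP
  rw [Finset.mem_filter] at hP
  obtain ⟨hPA, hodd⟩ := hP
  by_contra hPL
  have hcopL : IsCoprime P L := (hA P hPA).2.coprime_iff_not_dvd.mpr hPL
  set Q := ∏ R ∈ A.erase P, R with hQ
  have hPQ : P * Q = ∏ R ∈ A, R := Finset.mul_prod_erase A (fun R => R) hPA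
  have hLQ : L ∣ Q := by
    refine hcopL.symm.dvd_of_dvd_mul_left ?_
    rw [hPQ]
    exact hL.trans hE.dvd
  have hcop : IsCoprime P Q := by
    refine IsCoprime.prod_right fun R hR => ?_
    rw [Finset.mem_erase] at hR
    exact pairwise_cop A hA P R hPA hR.2 hR.1.symm
  obtain ⟨u, w, huw⟩ := hcop
  obtain ⟨y, hy⟩ := exists_rs_neg h2 P (hA P hPA).1 (hA P hPA).2
  let x := y * w * Q + u * P
  have hx1 : Q ∣ x - 1 := ⟨w * (y - 1), by simp only [x]; linear_combination huw⟩
  have hxy : P ∣ x - y := ⟨u - y * u, by simp only [x]; linear_combination y * huw⟩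
  have hval : χ (Ideal.Quotient.mk _ x) = -1 := by
    rw [hχ, ← Finset.mul_prod_erase A _ hPA, rs_congr P x y (hA P hPA).1 hxy, hy,
      hodd.neg_one_pow, Finset.prod_eq_one]
    · simp
    · intro R hR
      rw [rs_congr R x 1 (hA R (Finset.mem_of_mem_erase hR)).1
        ((Finset.dvd_prod_of_mem _ hR).trans hx1), rs_one_right]
      simp
  have hunit : IsUnit (Ideal.Quotient.mk (Ideal.span {E}) x) := by
    by_contra hnu
    rw [χ.map_nonunit hnu] at hval
    norm_num at hval
  have h5 := hχ₁ x hunit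
  have h6 : Ideal.Quotient.mk (Ideal.span {L}) x = 1 := by
    rw [← map_one (Ideal.Quotient.mk (Ideal.span {L})), Ideal.Quotient.eq,
      Ideal.mem_span_singleton]
    exact hLQ.trans hx1
  rw [h6, hval, map_one] at h5
  norm_num at h5

lemma prod_unit {ι : Type} (s : Finset ι) (c : ι → ℤ) (h : ∀ i ∈ s, IsUnit (c i)) :
    IsUnit (∏ i ∈ s, c i) := by
  induction s using Finset.induction_on with
  | empty => simp
  | insert a s ha ih =>
    rw [Finset.prod_insert ha]
    exact (h a (Finset.mem_insert_self _ _)).mul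
      (ih fun i hi => h i (Finset.mem_insert_of_mem hi))

/-- The formula for nonzero `D`. -/
lemma main_formula {F : Type} [Field F] [Fintype F] (h2 : ringChar F ≠ 2) (N : ℕ)
    (M a D G : F[X]) (hM : M.Monic) (hcop : IsCoprime a M) (hD0 : D ≠ 0)
    (hD : D = M ^ 2 * G + derivative a * M - a * derivative M) :
    ∃ (S : ℤ) (w : F[X]), IsUnit S ∧ ∀ g : F[X], (a + g * M).Monic → (a + g * M).natDegree = N →
      derivative g = G → pmu (a + g * M) = S *
        ∏ P ∈ (UniqueFactorizationMonoid.normalizedFactors D).toFinset with ¬ P ∣ M,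
          quadraticChar F (resultant P (w + g)) ^
            (UniqueFactorizationMonoid.normalizedFactors D).count P := by
  have hT : ∀ P ∈ (UniqueFactorizationMonoid.normalizedFactors D).toFinset,
      P.Monic ∧ Irreducible P := fun P hP => nf_monic D P (Multiset.mem_toFinset.mp hP)
  obtain ⟨c1, hc1, hcD⟩ := qc_rs_D D hD0 N
  generalize (UniqueFactorizationMonoid.normalizedFactors D).toFinset = T at *
  generalize hv : (fun P => (UniqueFactorizationMonoid.normalizedFactors D).count P) = v at *
  have hv' : ∀ P, (UniqueFactorizationMonoid.normalizedFactors D).count P = v P :=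
    fun P => congrFun hv P
  simp only [hv'] at *
  obtain ⟨w, hw⟩ : ∃ w, (∏ P ∈ T with ¬ P ∣ M, P) ∣ a - w * M := by
    have : IsCoprime M (∏ P ∈ T with ¬ P ∣ M, P) := by
      refine IsCoprime.prod_right fun P hP => ?_
      rw [Finset.mem_filter] at hP
      exact ((hT P hP.1).2.coprime_iff_not_dvd.mpr hP.2).symm
    obtain ⟨u, t, hut⟩ := this
    exact ⟨a * u, a * t, by linear_combination (-a) * hut⟩
  have hMa : quadraticChar F (resultant M a) * quadraticChar F (resultant M a) = 1 := by
    apply qc_sq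
    rw [Ne, rs_eq_zero _ _ hM]
    simpa using hcop.symm
  set c3 : ℤ := (-1) ^ N * quadraticChar F ((-1) ^ (N.choose 2)) with hc3
  set c0 : ℤ := quadraticChar F ((-1) ^ (N * M.natDegree)) * quadraticChar F (resultant M a) with hc0
  set cB : ℤ := ∏ P ∈ T with P ∣ M, quadraticChar F (resultant P a) ^ v P with hcB
  set cM : ℤ := ∏ P ∈ T with ¬ P ∣ M, quadraticChar F (resultant P M) ^ v P with hcM
  have hc3u : IsUnit c3 := by
    refine IsUnit.mul ?_ (qc_unit (by simp))
    exact IsUnit.pow _ (by simp)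
  have hc0sq : c0 * c0 = 1 := by
    have : quadraticChar F ((-1) ^ (N * M.natDegree)) * quadraticChar F ((-1) ^ (N * M.natDegree)) = 1 :=
      qc_sq (by simp)
    rw [hc0]
    linear_combination quadraticChar F (resultant M a) * quadraticChar F (resultant M a) * this + hMa
  have hcBu : IsUnit cB := by
    refine prod_unit _ _ fun P hP => IsUnit.pow _ (qc_unit ?_)
    rw [Finset.mem_filter] at hP
    rw [Ne, rs_eq_zero _ _ (hT P hP.1).1, not_not]
    exact (hcop.of_isCoprime_of_dvd_right hP.2).symm
  have hcMu : IsUnit cM := by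
    refine prod_unit _ _ fun P hP => IsUnit.pow _ (qc_unit ?_)
    rw [Finset.mem_filter] at hP
    rw [Ne, rs_eq_zero _ _ (hT P hP.1).1, not_not]
    exact (hT P hP.1).2.coprime_iff_not_dvd.mpr hP.2
  refine ⟨c3 * c0 * c1 * cB * cM, w, ?_, ?_⟩
  · exact (((hc3u.mul (IsUnit.of_mul_eq_one _ hc0sq)).mul hc1).mul hcBu).mul hcMu
  · intro g hf hN hg
    have hDf : M * derivative (a + g * M) - D = (a + g * M) * derivative M := by
      rw [hD, derivative_add, derivative_mul, hg]; ring
    have hpel : pmu (a + g * M) = c3 *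
        quadraticChar F (resultant (a + g * M) (derivative (a + g * M))) := by
      rw [pellet h2 (a + g * M) hf, map_mul, ← mul_assoc, hc3, ← hN]
    have e1 : quadraticChar F (resultant (a + g * M) (derivative (a + g * M))) *
        quadraticChar F (resultant (a + g * M) M) = quadraticChar F (resultant (a + g * M) D) := by
      rw [← map_mul, mul_comm, ← rs_mul_right _ _ _ hf, rs_congr _ _ D hf ⟨_, hDf⟩]
    have e2 : quadraticChar F (resultant (a + g * M) M) = c0 := by
      rw [resultant_comm, map_mul, rs_congr M _ a hM ⟨g, by ring⟩, hN]
    have e3 := hcD _ hf hN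
    rw [← Finset.prod_filter_mul_prod_filter_not T (fun P => P ∣ M)] at e3
    have e4 : ∏ P ∈ T with P ∣ M, quadraticChar F (resultant P (a + g * M)) ^ v P = cB := by
      refine Finset.prod_congr rfl fun P hP => ?_
      rw [Finset.mem_filter] at hP
      rw [rs_congr P _ a (hT P hP.1).1]
      rw [add_sub_cancel_left]
      exact hP.2.mul_left g
    have e5 : ∏ P ∈ T with ¬ P ∣ M, quadraticChar F (resultant P (a + g * M)) ^ v P =
        cM * ∏ P ∈ T with ¬ P ∣ M, quadraticChar F (resultant P (w + g)) ^ v P := by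
      rw [hcM, ← Finset.prod_mul_distrib]
      refine Finset.prod_congr rfl fun P hP => ?_
      have hPw := (Finset.dvd_prod_of_mem (fun P => P) hP).trans hw
      rw [Finset.mem_filter] at hP
      rw [rs_congr P _ (M * (w + g)) (hT P hP.1).1, rs_mul_right _ _ _ (hT P hP.1).1, map_mul,
        mul_pow]
      convert hPw using 1
      ring
    rw [e4, e5] at e3
    rw [e2, e3] at e1
    rw [hpel]
    generalize quadraticChar F (resultant (a + g * M) (derivative (a + g * M))) = X at *
    linear_combination c3 * c0 * e1 - c3 * X * hc0sq

end Aux12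

/-- **Möbius on arithmetic progressions as a Dirichlet character.** Let `p` be an odd prime,
`q` a power of `p`, `m, k ≥ 0`, `d ≥ 1` integers with `k ≠ d + m`, `M` monic of degree `m`,
`a` monic of degree `k` coprime to `M`, and `g` monic of degree `d`. With
`D = M² g′ + a′ M − a M′`, `E = rad(D)/gcd(M, rad(D))`, `E₁ = rad₁(D)/gcd(M, rad₁(D))`,
there exist `S ∈ {0, 1, −1}`, `w ∈ F_q[T]`, and a real Dirichlet character `χ` mod `E` with
conductor `E₁`, depending only on `(d, a, M, g′)` — i.e. serving every monic `g̃` of degree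
`d` with `g̃′ = g′` — such that `μ(a + g̃ M) = S · χ(w + g̃)`, and `S = 0 ↔ D = 0`. -/
theorem statement12 (p : ℕ) (hp : p.Prime) (hodd : Odd p)
    (q : ℕ) (hq : ∃ n : ℕ, 1 ≤ n ∧ q = p ^ n)
    (Fq : Type) [Field Fq] [Fintype Fq] (hcard : Fintype.card Fq = q)
    (m k d : ℕ) (hd : 1 ≤ d) (hk : k ≠ d + m)
    (M : Polynomial Fq) (hM : M.Monic) (hMdeg : M.natDegree = m)
    (a : Polynomial Fq) (ha : a.Monic) (hadeg : a.natDegree = k)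
    (hcop : IsCoprime a M)
    (g : Polynomial Fq) (hg : g.Monic) (hgdeg : g.natDegree = d)
    (D E E₁ : Polynomial Fq)
    (hD : D = M ^ 2 * derivative g + derivative a * M - a * derivative M)
    (hE : E = rad D / gcd M (rad D))
    (hE₁ : E₁ = rad1 D / gcd M (rad1 D)) :
    ∃ (S : ℤ) (w : Polynomial Fq) (χ : MulChar (Polynomial Fq ⧸ Ideal.span {E}) ℂ),
      -- `S ∈ {0, 1, −1}`
      (S = 0 ∨ S = 1 ∨ S = -1) ∧
      -- `χ` is real
      (∀ x : Polynomial Fq ⧸ Ideal.span {E},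
        χ x = 0 ∨ χ x = 1 ∨ χ x = -1) ∧
      -- the conductor of `χ` is `E₁`: it divides the modulus, `χ` is induced by a character
      -- mod `E₁`, and `E₁` has least degree among divisors of `E` with this property
      (E₁ ∣ E) ∧
      (∃ χ₁ : MulChar (Polynomial Fq ⧸ Ideal.span {E₁}) ℂ,
        ∀ x : Polynomial Fq, IsUnit (Ideal.Quotient.mk (Ideal.span {E}) x) →
          χ (Ideal.Quotient.mk (Ideal.span {E}) x)
            = χ₁ (Ideal.Quotient.mk (Ideal.span {E₁}) x)) ∧
      (∀ L : Polynomial Fq, L ∣ E →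
        (∃ χ₁ : MulChar (Polynomial Fq ⧸ Ideal.span {L}) ℂ,
          ∀ x : Polynomial Fq, IsUnit (Ideal.Quotient.mk (Ideal.span {E}) x) →
            χ (Ideal.Quotient.mk (Ideal.span {E}) x)
              = χ₁ (Ideal.Quotient.mk (Ideal.span {L}) x)) →
        E₁.natDegree ≤ L.natDegree) ∧
      -- `S`, `w`, `χ` serve every monic `g̃` of degree `d` with `g̃′ = g′`
      (∀ g' : Polynomial Fq, g'.Monic → g'.natDegree = d →
        derivative g' = derivative g →
        (pmu (a + g' * M) : ℂ)
          = (S : ℂ) * χ (Ideal.Quotient.mk (Ideal.span {E}) (w + g'))) ∧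
      -- `S = 0` iff `D = 0`
      (S = 0 ↔ D = 0) := by
  subst hMdeg hadeg hD hE hE₁
  have h2 : ringChar Fq ≠ 2 := by
    intro h
    have h3 := FiniteField.even_card_of_char_two h
    obtain ⟨n, hn, rfl⟩ := hq
    have h4 : Odd (p ^ n) := hodd.pow
    rw [hcard] at h3
    obtain ⟨j, hj⟩ := h4
    omega
  -- the shape of `a + g' M`
  have hshape : ∀ g' : Fq[X], g'.Monic → g'.natDegree = d →
      (a + g' * M).Monic ∧ (a + g' * M).natDegree = max a.natDegree (d + M.natDegree) := by
    intro g' hg' hd'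
    have hm : (g' * M).Monic := hg'.mul hM
    have hmd : (g' * M).natDegree = d + M.natDegree := by rw [hg'.natDegree_mul hM, hd']
    rcases lt_or_gt_of_ne hk with h | h
    · rw [← hmd] at h
      refine ⟨hm.add_of_right (degree_lt_degree h), ?_⟩
      rw [natDegree_add_eq_right_of_natDegree_lt h, ← hmd, max_eq_right h.le]
    · rw [← hmd] at h
      refine ⟨ha.add_of_left (degree_lt_degree h), ?_⟩
      rw [natDegree_add_eq_left_of_natDegree_lt h, ← hmd, max_eq_left h.le]
  set D := M ^ 2 * derivative g + derivative a * M - a * derivative M with hD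
  have hT : ∀ P ∈ (UniqueFactorizationMonoid.normalizedFactors D).toFinset,
      P.Monic ∧ Irreducible P := fun P hP => nf_monic D P (Multiset.mem_toFinset.mp hP)
  have hv0 : ∀ P ∈ (UniqueFactorizationMonoid.normalizedFactors D).toFinset,
      (UniqueFactorizationMonoid.normalizedFactors D).count P ≠ 0 := by
    intro P hP
    rw [Multiset.mem_toFinset] at hP
    exact Multiset.count_ne_zero.mpr hP
  have hEA : Associated (rad D / gcd M (rad D))
      (∏ P ∈ (UniqueFactorizationMonoid.normalizedFactors D).toFinset with ¬ P ∣ M, P) :=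
    div_gcd _ hT M
  have hE1A : Associated (rad1 D / gcd M (rad1 D))
      (∏ P ∈ ((UniqueFactorizationMonoid.normalizedFactors D).toFinset.filter
          fun P => Odd ((UniqueFactorizationMonoid.normalizedFactors D).count P)).filter
            (fun P => ¬ P ∣ M), P) := by
    have h5 : rad1 D = ∏ P ∈ (UniqueFactorizationMonoid.normalizedFactors D).toFinset.filter
          fun P => Odd ((UniqueFactorizationMonoid.normalizedFactors D).count P), P := by
      rw [rad1, Finset.prod_filter]
    rw [h5]
    exact div_gcd _ (fun P hP => hT P (Finset.mem_filter.mp hP).1) M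
  rw [Finset.filter_comm] at hE1A
  -- the formula
  have hform : ∃ (S : ℤ) (w : Fq[X]), (S = 0 ∨ S = 1 ∨ S = -1) ∧ (S = 0 ↔ D = 0) ∧
      ∀ g' : Fq[X], g'.Monic → g'.natDegree = d → derivative g' = derivative g →
        pmu (a + g' * M) = S *
        ∏ P ∈ (UniqueFactorizationMonoid.normalizedFactors D).toFinset with ¬ P ∣ M,
          quadraticChar Fq (resultant P (w + g')) ^
            (UniqueFactorizationMonoid.normalizedFactors D).count P := by
    by_cases hD0 : D = 0
    · refine ⟨0, 0, Or.inl rfl, by simp [hD0], ?_⟩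
      intro g' hg' hd' hdg
      rw [zero_mul]
      unfold pmu
      rw [if_neg]
      intro hsq
      obtain ⟨hf, hfd⟩ := hshape g' hg' hd'
      have hsep : IsCoprime (a + g' * M) (derivative (a + g' * M)) :=
        PerfectField.separable_iff_squarefree.mpr hsq
      have hcM : IsCoprime (a + g' * M) M := by
        have := hcop.add_mul_right_left g'
        simpa using this
      have hdvd : (a + g' * M) ∣ M * derivative (a + g' * M) := by
        refine ⟨derivative M, ?_⟩
        have h6 : M * derivative (a + g' * M) - D = (a + g' * M) * derivative M := by
          rw [hD, derivative_add, derivative_mul, hdg]; ring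
        rw [← h6, hD0, sub_zero]
      have hu := (hcM.mul_right hsep).isUnit_of_dvd' dvd_rfl hdvd
      have := natDegree_eq_zero_of_isUnit hu
      rw [hfd] at this
      omega
    · obtain ⟨S, w, hS, hSw⟩ := main_formula h2 (max a.natDegree (d + M.natDegree)) M a D
        (derivative g) hM hcop hD0 hD
      refine ⟨S, w, Or.inr (Int.isUnit_iff.mp hS), ?_, ?_⟩
      · simp [hD0, hS.ne_zero]
      · intro g' hg' hd' hdg
        exact hSw g' (hshape g' hg' hd').1 (hshape g' hg' hd').2 hdg
  clear_value D
  generalize rad D / gcd M (rad D) = E at *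
  generalize rad1 D / gcd M (rad1 D) = E₁ at *
  obtain ⟨S, w, hS, hS0, hSw⟩ := hform
  generalize hA : (UniqueFactorizationMonoid.normalizedFactors D).toFinset.filter
    (fun P => ¬ P ∣ M) = A at *
  have hAm : ∀ P ∈ A, P.Monic ∧ Irreducible P := by
    intro P hP
    rw [← hA] at hP
    exact hT P (Finset.mem_filter.mp hP).1
  have hAv : ∀ P ∈ A, (UniqueFactorizationMonoid.normalizedFactors D).count P ≠ 0 := by
    intro P hP
    rw [← hA] at hP
    exact hv0 P (Finset.mem_filter.mp hP).1
  have hA1m : ∀ P ∈ A.filter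
      (fun P => Odd ((UniqueFactorizationMonoid.normalizedFactors D).count P)),
      P.Monic ∧ Irreducible P := fun P hP => hAm P (Finset.mem_filter.mp hP).1
  obtain ⟨χ, hχ⟩ := charOf A (fun P => (UniqueFactorizationMonoid.normalizedFactors D).count P)
    hAm hAv E hEA
  obtain ⟨χ₁, hχ₁⟩ := charOf _ (fun P => (UniqueFactorizationMonoid.normalizedFactors D).count P)
    hA1m (fun P hP => hAv P (Finset.mem_filter.mp hP).1) E₁ hE1A
  have hE0 : E ≠ 0 := by
    rw [hEA.ne_zero_iff]
    exact Finset.prod_ne_zero_iff.mpr fun P hP => (hAm P hP).1.ne_zero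
  have hunit : ∀ x : Fq[X], IsUnit (Ideal.Quotient.mk (Ideal.span {E}) x) → ∀ P ∈ A,
      IsUnit (quadraticChar Fq (resultant P x)) := by
    intro x hx P hP
    apply qc_unit
    rw [Ne, rs_eq_zero _ _ (hAm P hP).1, not_not]
    rw [isUnit_mk_iff] at hx
    exact (hx.of_isCoprime_of_dvd_right
      ((Finset.dvd_prod_of_mem (fun P => P) hP).trans hEA.symm.dvd)).symm
  refine ⟨S, w, χ, hS, ?_, ?_, ⟨χ₁, ?_⟩, ?_, ?_, hS0⟩
  · intro z
    by_cases hz : IsUnit z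
    · right
      obtain ⟨x, rfl⟩ := Ideal.Quotient.mk_surjective z
      rw [hχ]
      have := prod_unit A (fun P => quadraticChar Fq (resultant P x) ^
        (UniqueFactorizationMonoid.normalizedFactors D).count P)
        (fun P hP => (hunit x hz P hP).pow _)
      rcases Int.isUnit_iff.mp this with h | h <;> rw [h] <;> simp
    · left
      exact χ.map_nonunit hz
  · refine hE1A.dvd.trans (Dvd.dvd.trans ?_ hEA.symm.dvd)
    exact Finset.prod_dvd_prod_of_subset _ _ _ (Finset.filter_subset _ _)
  · intro x hx
    rw [hχ, hχ₁, Finset.prod_filter]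
    congr 1
    refine Finset.prod_congr rfl fun P hP => ?_
    split_ifs with ho
    · rfl
    · rw [Nat.not_odd_iff_even] at ho
      rcases Int.isUnit_iff.mp (hunit x hx P hP) with h | h <;> rw [h]
      · simp
      · exact ho.neg_one_pow
  · rintro L hL ⟨χ₂, hχ₂⟩
    have h7 := conductor_min h2 A _ hAm E hEA χ hχ L hL χ₂ hχ₂
    exact natDegree_le_of_dvd (hE1A.dvd.trans h7) (ne_zero_of_dvd_ne_zero hE0 hL)
  · intro g' hg' hd' hdg
    rw [hSw g' hg' hd' hdg, hχ]
    push_cast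
    rfl
end

section
/- Let p be a prime, q a power of p, and m, d nonnegative integers. Let M be a squarefree monic polynomial of degree m in F_q[T] and let a ∈ F_q[T]. Then #{h ∈ F_q[T] : h = g′ for some monic g of degree d, and h ≡ a mod M} divided by #{g′ : g monic of degree d} is at most q^{−min{m, ⌊(d−1)/p⌋}}, where g′ denotes the derivative of g with respect to T. -/
open scoped Classical
open Polynomial Filter

theorem aux_ncard (F : Type) [Field F] [Fintype F] (n : ℕ) :
    (degreeLT F n : Set F[X]).Finite ∧ (degreeLT F n : Set F[X]).ncard = Fintype.card F ^ n := by
  have e := (degreeLTEquiv F n).toEquiv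
  constructor
  · exact @Set.toFinite _ _ (Finite.of_equiv _ e.symm)
  · rw [← Nat.card_coe_set_eq]
    exact (Nat.card_congr e).trans (by simp)

theorem aux_main (p : ℕ) (hp : p.Prime) (F : Type) [Field F] [Fintype F] [CharP F p]
    (d k : ℕ) (M : F[X]) (hMsf : Squarefree M) (hk : k ≤ M.natDegree)
    (hd : 0 < d) (hkd : k * p ≤ d - 1) (a : F[X]) 
    (hfin : {h : F[X] | ∃ g : F[X], g.Monic ∧ g.natDegree = d ∧ derivative g = h}.Finite) :
    {h : F[X] | (∃ g : F[X], g.Monic ∧ g.natDegree = d ∧ derivative g = h) ∧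
          M ∣ (h - a)}.ncard * Fintype.card F ^ k ≤
    {h : F[X] | ∃ g : F[X], g.Monic ∧ g.natDegree = d ∧ derivative g = h}.ncard := by
  have : Fact p.Prime := ⟨hp⟩
  rw [← (aux_ncard F k).2, ← Set.ncard_prod]
  refine Set.ncard_le_ncard_of_injOn (fun x => x.1 + x.2 ^ p) ?_ ?_ hfin
  · rintro ⟨h, f⟩ ⟨⟨⟨g, hg, hgd, rfl⟩, -⟩, hf⟩
    have hf : f ∈ degreeLT F k := hf
    rw [mem_degreeLT] at hf
    have hlt : (X * f ^ p).degree < g.degree := by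
      rw [degree_eq_natDegree hg.ne_zero, hgd]
      by_cases f0 : f = 0
      · simp [f0, hp.ne_zero]
      rw [degree_eq_natDegree f0] at hf
      have hf : f.natDegree < k := by exact_mod_cast hf
      refine degree_le_natDegree.trans_lt ?_
      norm_cast
      rw [natDegree_mul X_ne_zero (pow_ne_zero _ f0), natDegree_X, natDegree_pow]
      have := hp.two_le
      have : p * (f.natDegree + 1) ≤ k * p := by rw [mul_comm k]; gcongr; omega
      rw [mul_add] at this
      omega
    refine ⟨g + X * f ^ p, hg.add_of_left hlt, ?_, ?_⟩
    · rw [natDegree_add_eq_left_of_degree_lt hlt, hgd]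
    · simp [derivative_pow]
  · rintro ⟨h, f⟩ ⟨⟨-, h1⟩, hf⟩ ⟨h', f'⟩ ⟨⟨-, h2⟩, hf'⟩ heq
    simp only at heq h1 h2 hf hf'
    have h3 : M ∣ (f - f') ^ p := by
      rw [sub_pow_char]
      have := dvd_sub h2 h1
      have e : f ^ p - f' ^ p = h' - a - (h - a) := by linear_combination heq
      rwa [e]
    rw [hMsf.dvd_pow_iff_dvd hp.ne_zero] at h3
    have h4 : f - f' ∈ degreeLT F k := Submodule.sub_mem _ hf hf'
    have h5 : f - f' = 0 := by
      apply eq_zero_of_dvd_of_degree_lt h3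
      rw [mem_degreeLT] at h4
      refine h4.trans_le ?_
      rw [degree_eq_natDegree hMsf.ne_zero]
      exact_mod_cast hk
    have h6 : f = f' := sub_eq_zero.mp h5
    subst h6
    simpa using heq

/-- **Derivatives in arithmetic progressions.** Let `p` be a prime, `q` a power of `p`, `m, d`
nonnegative integers, `M` squarefree monic of degree `m`, and `a ∈ F_q[T]`. Then the number of
derivative values `h = g′` of monic `g` of degree `d` with `h ≡ a mod M`, divided by the total
number of derivative values of monic polynomials of degree `d`, is at most
`q^(−min{m, ⌊(d−1)/p⌋})`. -/
theorem statement13 (p : ℕ) (hp : p.Prime) (q : ℕ) (hq : ∃ n : ℕ, 1 ≤ n ∧ q = p ^ n)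
    (Fq : Type) [Field Fq] [Fintype Fq] (hcard : Fintype.card Fq = q)
    (m d : ℕ) (M : Polynomial Fq) (hM : M.Monic) (hMsf : Squarefree M)
    (hMdeg : M.natDegree = m) (a : Polynomial Fq) :
    (({h : Polynomial Fq |
        (∃ g : Polynomial Fq, g.Monic ∧ g.natDegree = d ∧ derivative g = h) ∧
          M ∣ (h - a)}.ncard : ℝ)
      / ({h : Polynomial Fq |
          ∃ g : Polynomial Fq, g.Monic ∧ g.natDegree = d ∧ derivative g = h}.ncard : ℝ))
      ≤ (q : ℝ) ^ (-(min (m : ℤ) (Int.fdiv ((d : ℤ) - 1) (p : ℤ)))) := by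
  obtain ⟨n, hn, hqn⟩ := hq
  have : Fact p.Prime := ⟨hp⟩
  have : CharP Fq p := charP_of_card_eq_prime_pow (f := n) (by rw [← hqn, ← hcard])
  have hq1 : (1 : ℝ) ≤ q := by
    rw [hqn]; exact_mod_cast Nat.one_le_pow _ _ hp.pos
  have hfin : {h : Fq[X] | ∃ g : Fq[X], g.Monic ∧ g.natDegree = d ∧ derivative g = h}.Finite := by
    refine ((aux_ncard Fq (d + 1)).1.image derivative).subset ?_
    rintro h ⟨g, hg, hgd, rfl⟩
    refine ⟨g, ?_, rfl⟩
    simp only [SetLike.mem_coe, mem_degreeLT]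
    rw [degree_eq_natDegree hg.ne_zero, hgd]
    exact_mod_cast Nat.lt_succ_self d
  have hpos : 0 < {h : Fq[X] | ∃ g : Fq[X], g.Monic ∧ g.natDegree = d ∧ derivative g = h}.ncard := by
    rw [Set.ncard_pos hfin]
    exact ⟨_, X ^ d, monic_X_pow d, natDegree_X_pow d, rfl⟩
  rw [div_le_iff₀ (by exact_mod_cast hpos)]
  have hp0 : (0 : ℤ) < p := by exact_mod_cast hp.pos
  rw [Int.fdiv_eq_ediv_of_nonneg _ hp0.le]
  rcases Nat.eq_zero_or_pos d with hd | hd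
  · have h1 : ((d : ℤ) - 1) / p ≤ 0 := by
      subst hd
      exact (Int.ediv_neg_of_neg_of_pos (by norm_num) hp0).le
    have h2 : (1 : ℝ) ≤ (q : ℝ) ^ (-(min (m : ℤ) (((d : ℤ) - 1) / (p : ℤ)))) := by
      apply one_le_zpow₀ hq1
      have := min_le_right (m : ℤ) (((d : ℤ) - 1) / (p : ℤ))
      omega
    refine le_trans ?_ (le_mul_of_one_le_left (Nat.cast_nonneg _) h2)
    exact Nat.cast_le.mpr (Set.ncard_le_ncard (fun h hh => hh.1) hfin)
  · have h1 : min (m : ℤ) (((d : ℤ) - 1) / (p : ℤ)) = ((min m ((d - 1) / p) : ℕ) : ℤ) := by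
      push_cast [Nat.cast_sub hd]
      rfl
    rw [h1, zpow_neg, zpow_natCast, inv_mul_eq_div, le_div_iff₀ (by positivity)]
    have := aux_main p hp Fq d (min m ((d - 1) / p)) M hMsf (by rw [hMdeg]; exact min_le_left _ _) hd
      ((Nat.mul_le_mul_right p (min_le_right _ _)).trans (Nat.div_mul_le_self _ _)) a hfin
    rw [hcard] at this
    exact_mod_cast this
end

section
/- Fix α > 0, ε > 0, and a prime power q. Then there exists a constant C depending only on ε, α, and q such that for all nonnegative integers d, m, k with d ≥ ε·(m + k), every monic M of degree m, every monic A of degree k, and every a ∈ F_q[T], one has #{g ∈ F_q[T] : deg g < d, and a + gM = λ·A·B² for some λ ∈ F_q and B ∈ F_q[T]} ≤ C·q^{(1/2 + α)·d}. -/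
open scoped Classical
open Polynomial Filter

lemma aux_fin {F : Type} [Field F] [Fintype F] (n : ℕ) :
    {p : F[X] | p.degree < (n : WithBot ℕ)}.Finite ∧
    {p : F[X] | p.degree < (n : WithBot ℕ)}.ncard = Fintype.card F ^ n := by
  have e := (Polynomial.degreeLTEquiv F n).toEquiv
  have hs : {p : F[X] | p.degree < (n : WithBot ℕ)} = (degreeLT F n : Set F[X]) := by
    ext p; simp [mem_degreeLT]
  rw [hs]
  constructor
  · have : Finite (degreeLT F n) := Finite.of_equiv _ e.symm
    exact Set.toFinite _
  · rw [← Nat.card_coe_set_eq]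
    refine (Nat.card_congr e).trans ?_
    simp

lemma aux_count {F : Type} [Field F] [Fintype F] (N : F[X]) (hN : N ≠ 0) (R : ℕ)
    (S : Finset F[X])
    (h : ∀ x ∈ S, ∀ y ∈ S, N ∣ x - y ∧ (x - y).degree < (R : WithBot ℕ)) :
    S.card ≤ Fintype.card F ^ (R - N.natDegree) := by
  rcases S.eq_empty_or_nonempty with rfl | ⟨b, hb⟩
  · simp
  rw [← (aux_fin (F := F) (R - N.natDegree)).2, ← Set.ncard_coe_finset]
  have key : ∀ x ∈ S, x = b + N * ((x - b) / N) := by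
    intro x hx
    rw [EuclideanDomain.mul_div_cancel' hN (h x hx b hb).1]; ring
  refine Set.ncard_le_ncard_of_injOn (fun x => (x - b) / N) ?_ ?_ (aux_fin _).1
  · intro x hx
    have h2 := (h x hx b hb).2
    have h1 := EuclideanDomain.mul_div_cancel' hN (h x hx b hb).1
    simp only [Set.mem_ofPred_eq]
    by_cases h0 : (x - b) / N = 0
    · rw [h0]; simp
    · rw [← h1, degree_mul, degree_eq_natDegree hN, degree_eq_natDegree h0] at h2
      rw [degree_eq_natDegree h0]
      norm_cast at h2 ⊢
      omega
  · intro x hx y hy hxy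
    simp only at hxy
    rw [key x hx, key y hy, hxy]

open UniqueFactorizationMonoid in
lemma aux_split {F : Type} [Field F] (M x y : F[X]) (hM : M ≠ 0) (h : M ∣ x * y) :
    ∃ t ∈ (normalizedFactors M).powerset.toFinset, t.prod ∣ x ∧
      (normalizedFactors M - t).prod ∣ y ∧ t.prod ≠ 0 ∧ (normalizedFactors M - t).prod ≠ 0 ∧
      t.prod.natDegree + (normalizedFactors M - t).prod.natDegree = M.natDegree := by
  obtain ⟨M1, M2, h1, h2, rfl⟩ := exists_dvd_and_dvd_of_dvd_mul h
  have n1 : M1 ≠ 0 := left_ne_zero_of_mul hM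
  have n2 : M2 ≠ 0 := right_ne_zero_of_mul hM
  have a1 := prod_normalizedFactors n1
  have a2 := prod_normalizedFactors n2
  refine ⟨normalizedFactors M1, ?_⟩
  rw [normalizedFactors_mul n1 n2, add_tsub_cancel_left]
  refine ⟨by simp, a1.dvd.trans h1, a2.dvd.trans h2, a1.symm.ne_zero_iff.1 n1,
    a2.symm.ne_zero_iff.1 n2, ?_⟩
  rw [natDegree_mul n1 n2]
  congr 1
  · exact natDegree_eq_of_degree_eq (degree_eq_degree_of_associated a1)
  · exact natDegree_eq_of_degree_eq (degree_eq_degree_of_associated a2)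

lemma aux_ms {F : Type} [Field F] [Fintype F] (D : ℕ) (P : Finset F[X])
    (hP : ∀ p : F[X], p.natDegree ≤ D → p ∈ P) (s : Multiset F[X]) :
    s.powerset.toFinset.card ≤ 2 ^ (s.filter (fun p => D < p.natDegree)).card *
      (s.card + 1) ^ P.card := by
  have : s.powerset.toFinset.card ≤
     ((s.filter (fun p => D < p.natDegree)).powerset.toFinset ×ˢ
        (Fintype.piFinset (fun _ : P => Finset.range (s.card + 1)))).card := by
    refine Finset.card_le_card_of_injOn
      (fun t => (t.filter (fun p => D < p.natDegree), fun p : P => t.count p.1)) ?_ ?_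
    · intro t ht
      simp only [Finset.mem_coe, Multiset.mem_toFinset, Multiset.mem_powerset] at ht
      simp only [Finset.mem_coe, Finset.mem_product, Multiset.mem_toFinset,
        Multiset.mem_powerset, Fintype.mem_piFinset, Finset.mem_range]
      refine ⟨Multiset.filter_le_filter _ ht, fun p => ?_⟩
      have := Multiset.count_le_card p.1 t
      have := Multiset.card_le_card ht
      omega
    · intro t _ u _ h
      simp only [Prod.mk.injEq] at h
      ext p
      by_cases hp : D < p.natDegree
      · have := congrArg (Multiset.count p) h.1
        simpa [Multiset.count_filter, hp] using this
      · exact congrFun h.2 ⟨p, hP p (not_lt.1 hp)⟩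
  refine this.trans ?_
  rw [Finset.card_product, Fintype.card_piFinset]
  simp only [Finset.card_range, Finset.prod_const, Finset.card_univ, Fintype.card_coe]
  gcongr
  exact (Multiset.toFinset_card_le _).trans (Multiset.card_powerset _).le

open UniqueFactorizationMonoid in
lemma aux_div {F : Type} [Field F] [Fintype F] (η : ℝ) (hη : 0 < η) :
    ∃ C : ℝ, 0 < C ∧ ∀ M : F[X], M ≠ 0 →
      ((normalizedFactors M).powerset.toFinset.card : ℝ) ≤
        C * (Fintype.card F : ℝ) ^ (η * M.natDegree) := by
  obtain ⟨D, hD⟩ := exists_nat_gt (2 / η)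
  have hq : (2 : ℝ) ≤ Fintype.card F := by exact_mod_cast Fintype.one_lt_card (α := F)
  set q : ℝ := (Fintype.card F : ℝ)
  have hDp : (0 : ℝ) < D := lt_trans (by positivity) hD
  set P : Finset F[X] := (aux_fin (F := F) (D + 1)).1.toFinset
  have hP : ∀ p : F[X], p.natDegree ≤ D → p ∈ P := by
    intro p hp
    simp only [P, Set.Finite.mem_toFinset, Set.mem_ofPred_eq]
    refine degree_le_natDegree.trans_lt ?_
    exact_mod_cast Nat.lt_succ_of_le hp
  have hlog : 0 < Real.log q := Real.log_pos (by linarith)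
  set c : ℝ := η / 2 * Real.log q with hc
  have hcp : 0 < c := by positivity
  set K := P.card
  refine ⟨(K.factorial : ℝ) / c ^ K * Real.exp c, by positivity, fun M hM => ?_⟩
  set s := normalizedFactors M with hs
  set m := M.natDegree with hm
  have hpos : ∀ p ∈ s, 1 ≤ p.natDegree := fun p hp =>
    (irreducible_of_normalized_factor p hp).natDegree_pos
  have hsum : (s.map natDegree).sum = m := by
    rw [← natDegree_multiset_prod]
    · exact natDegree_eq_of_degree_eq
        (degree_eq_degree_of_associated (prod_normalizedFactors hM))
    · exact zero_notMem_normalizedFactors M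
  have hcard : s.card ≤ m := by
    rw [← hsum]
    have := Multiset.card_nsmul_le_sum (s := s.map natDegree) (a := 1) (by simpa using hpos)
    simpa using this
  have hbig : (s.filter (fun p => D < p.natDegree)).card * D ≤ m := by
    have h1 := Multiset.card_nsmul_le_sum
      (s := (s.filter (fun p => D < p.natDegree)).map natDegree) (a := D)
      (by
        intro x hx
        simp only [Multiset.mem_map, Multiset.mem_filter] at hx
        obtain ⟨p, hp, rfl⟩ := hx
        exact hp.2.le)
    have h2 : ((s.filter (fun p => D < p.natDegree)).map natDegree).sum ≤ m := by
      rw [← hsum]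
      obtain ⟨u, hu⟩ := Multiset.le_iff_exists_add.1
        (Multiset.filter_le (fun p : F[X] => D < p.natDegree) s)
      conv_rhs => rw [hu]
      rw [Multiset.map_add, Multiset.sum_add]
      exact Nat.le_add_right _ _
    simp only [Multiset.card_map, smul_eq_mul] at h1
    exact h1.trans h2
  set L := (s.filter (fun p => D < p.natDegree)).card
  have h0 : ((s.powerset.toFinset.card : ℕ) : ℝ) ≤ 2 ^ L * ((s.card : ℝ) + 1) ^ K := by
    exact_mod_cast aux_ms D P hP s
  have h1 : (2 : ℝ) ^ L ≤ Real.exp (c * m) := by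
    have hL : (L : ℝ) ≤ η / 2 * m := by
      have h : (L : ℝ) * D ≤ m := by exact_mod_cast hbig
      have h' : 1 ≤ η / 2 * D := by
        rw [div_lt_iff₀ hη] at hD; linarith
      nlinarith [mul_le_mul_of_nonneg_left h' (Nat.cast_nonneg (α := ℝ) L)]
    calc (2 : ℝ) ^ L ≤ q ^ L := by gcongr
      _ = Real.exp (Real.log q * L) := by
        rw [← Real.rpow_natCast, Real.rpow_def_of_pos (by linarith)]
      _ ≤ _ := by
        apply Real.exp_le_exp.2
        rw [hc]; nlinarith
  have h2 : ((s.card : ℝ) + 1) ^ K ≤ (K.factorial : ℝ) / c ^ K * Real.exp (c * (m + 1)) := by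
    have h := Real.pow_div_factorial_le_exp (c * (m + 1)) (by positivity) K
    rw [div_le_iff₀ (by positivity), mul_pow] at h
    have h3 : ((s.card : ℝ) + 1) ^ K ≤ ((m : ℝ) + 1) ^ K := by
      gcongr
    refine h3.trans ?_
    rw [div_mul_eq_mul_div, le_div_iff₀ (by positivity)]
    linarith
  calc _ ≤ _ := h0
    _ ≤ Real.exp (c * m) * ((K.factorial : ℝ) / c ^ K * Real.exp (c * (m + 1))) := by gcongr
    _ = (K.factorial : ℝ) / c ^ K * Real.exp c * (Real.exp (c * m) * Real.exp (c * m)) := by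
      rw [mul_add, mul_one, Real.exp_add]; ring
    _ = _ := by
      rw [← Real.exp_add, Real.rpow_def_of_pos (by linarith), hc]
      congr 2; ring

open UniqueFactorizationMonoid in
lemma aux_lam {F : Type} [Field F] [Fintype F] (d : ℕ) (M A a : F[X]) (hM : M ≠ 0) (hA : A ≠ 0) :
    ∃ M' : F[X], M' ≠ 0 ∧ M'.natDegree ≤ M.natDegree ∧ ∀ (l : F) (S : Finset F[X]),
      (∀ g ∈ S, g.degree < (d : WithBot ℕ) ∧ ∃ B, a + g * M = C l * A * B ^ 2) →
      S.card ≤ Fintype.card F ^ ((d + 1) / 2) *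
        ((normalizedFactors M').powerset.toFinset.card * 4) := by
  obtain ⟨G, hGM, hGA, hG⟩ : ∃ G, G = gcd M A ∧ G ∣ M ∧ G ∣ A :=
    ⟨_, rfl, gcd_dvd_left _ _, gcd_dvd_right _ _⟩
  obtain ⟨M', hM'⟩ := hGA
  obtain ⟨A', hA'⟩ := hG
  have hG0 : G ≠ 0 := by rintro rfl; simp at hM'; exact hM hM'
  have hM0 : M' ≠ 0 := by rintro rfl; simp at hM'; exact hM hM'
  have hA0 : A' ≠ 0 := by rintro rfl; simp at hA'; exact hA hA'
  have hcop : IsCoprime M' A' := by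
    have : IsUnit (gcd M' A') := by
      have h1 : G * gcd M' A' ∣ G := by
        conv_rhs => rw [hGM]
        exact dvd_gcd (by rw [hM']; exact mul_dvd_mul_left _ (gcd_dvd_left _ _))
          (by rw [hA']; exact mul_dvd_mul_left _ (gcd_dvd_right _ _))
      obtain ⟨u, hu⟩ := h1
      refine IsUnit.of_mul_eq_one u (mul_left_cancel₀ hG0 ?_)
      rw [mul_one, ← mul_assoc]; exact hu.symm
    exact (gcd_isUnit_iff _ _).1 this
  have hdM : M.natDegree = G.natDegree + M'.natDegree := by rw [hM', natDegree_mul hG0 hM0]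
  have hdA : A.natDegree = G.natDegree + A'.natDegree := by rw [hA', natDegree_mul hG0 hA0]
  refine ⟨M', hM0, by omega, fun l S hS => ?_⟩
  set s := normalizedFactors M' with hs
  have hq1 : 1 ≤ Fintype.card F := Fintype.card_pos
  by_cases hl : l = 0
  · have h1 : S.card ≤ 1 := by
      rw [Finset.card_le_one]
      intro g hg g' hg'
      obtain ⟨_, B, hB⟩ := hS g hg
      obtain ⟨_, B', hB'⟩ := hS g' hg'
      rw [hl] at hB hB'
      simp only [map_zero, zero_mul] at hB hB'
      exact mul_right_cancel₀ hM (add_left_cancel (hB.trans hB'.symm))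
    have h2 : 1 ≤ s.powerset.toFinset.card := Finset.card_pos.2 ⟨s, by simp⟩
    have h3 : 1 ≤ Fintype.card F ^ ((d + 1) / 2) := Nat.one_le_pow _ _ hq1
    nlinarith
  rcases S.eq_empty_or_nonempty with rfl | ⟨g0, hg0⟩
  · simp
  obtain ⟨hd0, B0, hB0⟩ := hS g0 hg0
  set R : ℕ := (d + M.natDegree - A.natDegree + 1) / 2 with hR
  -- data for each g
  have hdata : ∀ g ∈ S, ∃ (B : F[X]) (i : Multiset F[X] × Bool × Bool),
      a + g * M = C l * A * B ^ 2 ∧ i.1 ∈ s.powerset.toFinset ∧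
      (∃ N : F[X], N = (if i.2.1 then i.1.prod else (s - i.1).prod) ∧ N ≠ 0 ∧
        M'.natDegree ≤ 2 * N.natDegree ∧ N ∣ B - (if i.2.1 then B0 else - B0)) ∧
      (B - (if i.2.2 then B0 else - B0)).degree < (R : WithBot ℕ) := by
    intro g hg
    obtain ⟨hd, B, hB⟩ := hS g hg
    have heq : C l * A * ((B - B0) * (B + B0)) = (g - g0) * M := by
      linear_combination hB0 - hB
    have hdvd : M' ∣ (B - B0) * (B + B0) := by
      have h1 : C l * A' * ((B - B0) * (B + B0)) = (g - g0) * M' := by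
        apply mul_left_cancel₀ hG0
        rw [hA', hM'] at heq
        linear_combination heq
      have h2 : M' ∣ A' * (C l * ((B - B0) * (B + B0))) := by
        refine ⟨g - g0, ?_⟩
        linear_combination h1
      have h3 := hcop.dvd_of_dvd_mul_left h2
      have hu : IsUnit (C l) := isUnit_C.2 (isUnit_iff_ne_zero.2 hl)
      exact (hu.dvd_mul_left).1 h3
    obtain ⟨t, ht, t1, t2, t3, t4, t5⟩ := aux_split M' _ _ hM0 hdvd
    rw [← hs] at ht t2 t4 t5
    have hb1 : ∃ b : Bool, (∃ N : F[X], N = (if b then t.prod else (s - t).prod) ∧ N ≠ 0 ∧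
        M'.natDegree ≤ 2 * N.natDegree ∧ N ∣ B - (if b then B0 else - B0)) := by
      by_cases hh : M'.natDegree ≤ 2 * t.prod.natDegree
      · exact ⟨true, t.prod, by simp, t3, hh, by simpa using t1⟩
      · exact ⟨false, (s - t).prod, by simp, t4, by omega, by simpa using t2⟩
    have hb2 : ∃ b : Bool, (B - (if b then B0 else - B0)).degree < (R : WithBot ℕ) := by
      by_cases e1 : B - B0 = 0
      · exact ⟨true, by simp [e1]⟩
      by_cases e2 : B + B0 = 0
      · exact ⟨false, by simp [e2]⟩
      have hgg : g - g0 ≠ 0 := by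
        intro h
        rw [h, zero_mul] at heq
        simp [hl, hA, e1, e2] at heq
      have h1 := congrArg natDegree heq
      rw [natDegree_mul (mul_ne_zero (by simpa using hl) hA) (mul_ne_zero e1 e2),
        natDegree_mul e1 e2, natDegree_C_mul hl, natDegree_mul hgg hM] at h1
      have h2 : (g - g0).natDegree < d :=
        (natDegree_lt_iff_degree_lt hgg).2 ((degree_sub_le _ _).trans_lt (max_lt hd hd0))
      by_cases hh : (B - B0).natDegree ≤ (B + B0).natDegree
      · refine ⟨true, ?_⟩
        simp only [if_true]
        rw [← natDegree_lt_iff_degree_lt e1]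
        omega
      · refine ⟨false, ?_⟩
        simp only [Bool.false_eq_true, if_false, sub_neg_eq_add]
        rw [← natDegree_lt_iff_degree_lt e2]
        omega
    obtain ⟨b1, hb1⟩ := hb1
    obtain ⟨b2, hb2⟩ := hb2
    exact ⟨B, (t, b1, b2), hB, ht, hb1, hb2⟩
  choose! Bf f hf1 hf2 hf3 hf4 using hdata
  have hmain := Finset.card_le_mul_card_image_of_maps_to (s := S)
    (t := s.powerset.toFinset ×ˢ (Finset.univ : Finset (Bool × Bool))) (f := f)
    (fun g hg => by simpa using hf2 g hg) (Fintype.card F ^ ((d + 1) / 2)) ?_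
  · refine hmain.trans (le_of_eq ?_)
    rw [Finset.card_product]; rfl
  · intro i _
    set T := S.filter (fun g => f g = i)
    rcases T.eq_empty_or_nonempty with hT | ⟨g1, hg1⟩
    · rw [hT]; simp
    have hTS : ∀ g ∈ T, g ∈ S ∧ f g = i := fun g hg => by simpa [T] using hg
    obtain ⟨N, hN, hN0, hNd, -⟩ := hf3 g1 (hTS g1 hg1).1
    rw [(hTS g1 hg1).2] at hN
    have hinj : Set.InjOn Bf T := by
      intro x hx y hy hxy
      have e1 := hf1 x (hTS x hx).1
      have e2 := hf1 y (hTS y hy).1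
      rw [hxy, ← e2] at e1
      exact mul_right_cancel₀ hM (add_left_cancel e1)
    rw [← Finset.card_image_of_injOn hinj]
    refine (aux_count N hN0 R _ ?_).trans (Nat.pow_le_pow_right hq1 (by omega))
    intro x hx y hy
    obtain ⟨x, hx', rfl⟩ := Finset.mem_image.1 hx
    obtain ⟨y, hy', rfl⟩ := Finset.mem_image.1 hy
    obtain ⟨hx, hxi⟩ := hTS x hx'
    obtain ⟨hy, hyi⟩ := hTS y hy'
    obtain ⟨N1, hN1, -, -, h1⟩ := hf3 x hx
    obtain ⟨N2, hN2, -, -, h2⟩ := hf3 y hy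
    have d1 := hf4 x hx
    have d2 := hf4 y hy
    rw [hxi] at hN1 h1 d1
    rw [hyi] at hN2 h2 d2
    rw [← hN] at hN1 hN2
    subst hN1 hN2
    constructor
    · have := dvd_sub h1 h2
      rwa [sub_sub_sub_cancel_right] at this
    · rw [← sub_sub_sub_cancel_right _ _ (if i.2.2 then B0 else - B0)]
      exact (degree_sub_le _ _).trans_lt (max_lt d1 d2)

/-- **Counting squares in arithmetic progressions.** Fix `α, ε > 0` and a prime power `q`.
There is a constant `C` such that for all nonnegative integers `d, m, k` with
`d ≥ ε (m + k)`, every monic `M` of degree `m`, every monic `A` of degree `k`, and every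
`a ∈ F_q[T]`, the number of `g` with `deg g < d` and `a + g M = λ A B²` for some `λ ∈ F_q`
and `B ∈ F_q[T]` is at most `C q^((1/2 + α) d)`. -/
theorem statement14 (α ε : ℝ) (hα : 0 < α) (hε : 0 < ε) (q : ℕ) (hq : IsPrimePow q)
    (Fq : Type) [Field Fq] [Fintype Fq] (hcard : Fintype.card Fq = q) :
    ∃ C : ℝ, ∀ d m k : ℕ, ε * ((m : ℝ) + (k : ℝ)) ≤ (d : ℝ) →
      ∀ M : Polynomial Fq, M.Monic → M.natDegree = m →
      ∀ A : Polynomial Fq, A.Monic → A.natDegree = k →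
      ∀ a : Polynomial Fq,
      ({g : Polynomial Fq | g.degree < (d : WithBot ℕ) ∧
          ∃ lam : Fq, ∃ B : Polynomial Fq,
            a + g * M = Polynomial.C lam * A * B ^ 2}.ncard : ℝ)
        ≤ C * (q : ℝ) ^ ((1 / 2 + α) * (d : ℝ)) := by
  obtain ⟨C1, hC1, hdiv⟩ := aux_div (F := Fq) (α * ε) (by positivity)
  refine ⟨C1 * 4 * q * q, fun d m k hd M hM hMm A hA hAk a => ?_⟩
  obtain ⟨M', hM0, hMd, hlam⟩ := aux_lam d M A a hM.ne_zero hA.ne_zero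
  have hdiv := hdiv M' hM0
  rw [hcard] at hlam hdiv
  have hq1 : (1 : ℝ) ≤ q := by exact_mod_cast hq.one_lt.le
  set W := (UniqueFactorizationMonoid.normalizedFactors M').powerset.toFinset.card
  have hfin : {g : Polynomial Fq | g.degree < (d : WithBot ℕ) ∧
          ∃ lam : Fq, ∃ B : Polynomial Fq,
            a + g * M = Polynomial.C lam * A * B ^ 2}.Finite :=
    (aux_fin d).1.subset (fun g hg => hg.1)
  rw [Set.ncard_eq_toFinset_card _ hfin]
  set S := hfin.toFinset
  have hS : ∀ g ∈ S, g.degree < (d : WithBot ℕ) ∧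
          ∃ lam : Fq, ∃ B : Polynomial Fq,
            a + g * M = Polynomial.C lam * A * B ^ 2 := fun g hg => by simpa [S] using hg
  have hS2 : ∀ g ∈ S, ∃ lam : Fq, ∃ B : Polynomial Fq,
            a + g * M = Polynomial.C lam * A * B ^ 2 := fun g hg => (hS g hg).2
  choose! lf hlf using hS2
  have hmain : S.card ≤ (q ^ ((d + 1) / 2) * (W * 4)) * (Finset.univ : Finset Fq).card := by
    refine Finset.card_le_mul_card_image_of_maps_to (f := lf) (fun g _ => Finset.mem_univ _) _ ?_
    intro l _
    refine hlam l _ ?_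
    intro g hg
    obtain ⟨hg', rfl⟩ := Finset.mem_filter.1 hg
    exact ⟨(hS g hg').1, hlf g hg'⟩
  rw [Finset.card_univ, hcard] at hmain
  have h1 : (q : ℝ) ^ ((d + 1) / 2) ≤ q * (q : ℝ) ^ ((1 / 2 : ℝ) * d) := by
    rw [← Real.rpow_natCast]
    calc (q : ℝ) ^ (((d + 1) / 2 : ℕ) : ℝ) ≤ (q : ℝ) ^ (1 + (1 / 2 : ℝ) * d) := by
          apply Real.rpow_le_rpow_of_exponent_le hq1
          have : (((d + 1) / 2 : ℕ) : ℝ) ≤ ((d + 1 : ℕ) : ℝ) / 2 := Nat.cast_div_le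
          push_cast at this ⊢
          linarith
      _ = _ := by rw [Real.rpow_add (by linarith), Real.rpow_one]
  have h2 : (W : ℝ) ≤ C1 * (q : ℝ) ^ (α * d) := by
    refine hdiv.trans ?_
    have h3 : (M'.natDegree : ℝ) ≤ m := by exact_mod_cast hMm ▸ hMd
    have h4 : (0 : ℝ) ≤ k := Nat.cast_nonneg k
    refine mul_le_mul_of_nonneg_left (Real.rpow_le_rpow_of_exponent_le hq1 ?_) hC1.le
    rw [mul_assoc]
    refine mul_le_mul_of_nonneg_left (le_trans ?_ hd) hα.le
    exact mul_le_mul_of_nonneg_left (by linarith) hε.le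
  calc (S.card : ℝ) ≤ ((q : ℝ) ^ ((d + 1) / 2) * (W * 4)) * q := by exact_mod_cast hmain
    _ ≤ ((q * (q : ℝ) ^ ((1 / 2 : ℝ) * d)) * ((C1 * (q : ℝ) ^ (α * d)) * 4)) * q := by gcongr
    _ = _ := by
      rw [add_mul, Real.rpow_add (by linarith)]; ring
end

section
/- Fix a prime power q and ε > 0. Then there exists a constant C depending only on q and ε such that for all nonnegative integers d, m and every squarefree monic M of degree m in F_q[T], one has | Σ_{k=1}^{d} k·q^{−k} · ( Σ_{A ∈ M_k, gcd(A,M)=1} μ(A) ) + q^m/φ(M) | ≤ C·q^{ε·(m+d) − d}. -/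
open scoped Classical
open Polynomial Filter

section aux
variable {F : Type} [Field F] [Fintype F]

lemma aux_finite (k : ℕ) : {A : F[X] | A.Monic ∧ A.natDegree = k}.Finite := by
  have : Finite {A : F[X] // A.Monic ∧ A.natDegree = k} :=
    Finite.of_equiv (Fin k → F)
      ((monicEquivDegreeLT (R := F) k).trans (degreeLTEquiv F k).toEquiv).symm
  exact Set.finite_coe_iff.1 this

noncomputable def amon (F : Type) [Field F] [Fintype F] (k : ℕ) : Finset F[X] :=
  (aux_finite (F := F) k).toFinset

lemma mem_amon {k : ℕ} {A : F[X]} : A ∈ amon F k ↔ A.Monic ∧ A.natDegree = k := by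
  simp [amon]

lemma card_amon (k : ℕ) : (amon F k).card = Fintype.card F ^ k := by
  have h1 : Nat.card {A : F[X] // A.Monic ∧ A.natDegree = k} = Fintype.card F ^ k := by
    rw [Nat.card_congr ((monicEquivDegreeLT (R := F) k).trans (degreeLTEquiv F k).toEquiv)]
    simp
  rw [← h1, amon, ← Nat.card_eq_card_finite_toFinset]
  rfl

/-- monic of degree k not divisible by elements of S -/
noncomputable def sft (S : Finset F[X]) (k : ℕ) : Finset F[X] :=
  (amon F k).filter (fun A => ∀ P ∈ S, ¬ P ∣ A)

lemma mem_sft {S : Finset F[X]} {k : ℕ} {A : F[X]} :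
    A ∈ sft S k ↔ (A.Monic ∧ A.natDegree = k) ∧ ∀ P ∈ S, ¬ P ∣ A := by
  simp [sft, mem_amon]

lemma split_gen (h : F[X] → ℝ) (S : Finset F[X]) (P : F[X]) (hP : P.Monic ∧ Irreducible P)
    (hS : ∀ Q ∈ S, Q.Monic ∧ Irreducible Q) (hPS : P ∉ S) (k : ℕ) :
    ∑ A ∈ sft S k, h A = ∑ A ∈ sft (insert P S) k, h A +
      if P.natDegree ≤ k then ∑ B ∈ sft S (k - P.natDegree), h (P * B) else 0 := by
  rw [← Finset.sum_filter_add_sum_filter_not (sft S k) (fun A => ¬ P ∣ A)]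
  congr 1
  · apply Finset.sum_congr _ (fun _ _ => rfl)
    ext A
    simp only [Finset.mem_filter, mem_sft, Finset.mem_insert, forall_eq_or_imp]
    tauto
  · have key : ∀ Q ∈ S, ∀ B, Q ∣ P * B → Q ∣ B := by
      intro Q hQ B hd
      rcases (hS Q hQ).2.prime.dvd_or_dvd hd with h1 | h1
      · exfalso
        have := (hS Q hQ).2.associated_of_dvd hP.2 h1
        have := eq_of_monic_of_associated (hS Q hQ).1 hP.1 this
        exact hPS (this ▸ hQ)
      · exact h1
    split_ifs with hk
    · symm
      apply Finset.sum_bij (fun B _ => P * B)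
      · intro B hB
        simp only [Finset.mem_filter, mem_sft, not_not] at hB ⊢
        refine ⟨⟨⟨hP.1.mul hB.1.1, ?_⟩, ?_⟩, dvd_mul_right _ _⟩
        · rw [hP.1.natDegree_mul hB.1.1, hB.1.2]; omega
        · intro Q hQ hd
          exact hB.2 Q hQ (key Q hQ B hd)
      · intro B _ B' _ e
        exact mul_left_cancel₀ hP.1.ne_zero e
      · intro A hA
        simp only [Finset.mem_filter, mem_sft, not_not] at hA
        obtain ⟨B, rfl⟩ := hA.2
        have hB : B.Monic := hP.1.of_mul_monic_left hA.1.1.1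
        refine ⟨B, ?_, rfl⟩
        rw [mem_sft]
        refine ⟨⟨hB, ?_⟩, fun Q hQ hd => hA.1.2 Q hQ (hd.mul_left _)⟩
        have := hA.1.1.2
        rw [hP.1.natDegree_mul hB] at this; omega
      · intros; rfl
    · apply Finset.sum_eq_zero
      intro A hA
      exfalso
      simp only [Finset.mem_filter, mem_sft, not_not] at hA
      apply hk
      rw [← hA.1.1.2]
      exact natDegree_le_of_dvd hA.2 hA.1.1.1.ne_zero

lemma pmu_mul_prime (P B : F[X]) (hP : P.Monic ∧ Irreducible P) (hB : B.Monic) :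
    (pmu (P * B) : ℝ) = if P ∣ B then 0 else - (pmu B : ℝ) := by
  split_ifs with h
  · have : ¬ Squarefree (P * B) := by
      intro hs
      obtain ⟨C, rfl⟩ := h
      exact hP.2.not_isUnit (hs P (by rw [← mul_assoc]; exact dvd_mul_right _ _))
    simp [pmu, this]
  · have h1 : Squarefree (P * B) ↔ Squarefree B := by
      rw [squarefree_mul_iff, hP.2.isRelPrime_iff_not_dvd]
      simp [h, hP.2.squarefree]
    unfold pmu
    rw [h1]
    split_ifs
    · rw [UniqueFactorizationMonoid.normalizedFactors_mul hP.1.ne_zero hB.ne_zero,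
        UniqueFactorizationMonoid.normalizedFactors_irreducible hP.2]
      simp [pow_add, pow_succ]
    · simp

noncomputable def serA (S : Finset F[X]) : PowerSeries ℝ :=
  PowerSeries.mk fun k => ∑ A ∈ sft S k, (pmu A : ℝ)
noncomputable def serN (S : Finset F[X]) : PowerSeries ℝ :=
  PowerSeries.mk fun k => ∑ A ∈ sft S k, (1 : ℝ)
noncomputable def serE (S : Finset F[X]) : PowerSeries ℝ :=
  ∏ P ∈ S, (1 - PowerSeries.X ^ P.natDegree)

lemma serA_step (S : Finset F[X]) (P : F[X]) (hP : P.Monic ∧ Irreducible P)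
    (hS : ∀ Q ∈ S, Q.Monic ∧ Irreducible Q) (hPS : P ∉ S) :
    serA S = serA (insert P S) * (1 - PowerSeries.X ^ P.natDegree) := by
  ext k
  rw [mul_sub, mul_one, map_sub, PowerSeries.coeff_mul_X_pow']
  simp only [serA, PowerSeries.coeff_mk]
  rw [split_gen _ S P hP hS hPS k]
  rw [sub_eq_add_neg]
  congr 1
  split_ifs with hk
  · rw [← Finset.sum_neg_distrib]
    have : sft (insert P S) (k - P.natDegree) =
        (sft S (k - P.natDegree)).filter (fun B => ¬ P ∣ B) := by
      ext A
      simp only [Finset.mem_filter, mem_sft, Finset.mem_insert, forall_eq_or_imp]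
      tauto
    rw [this, Finset.sum_filter]
    apply Finset.sum_congr rfl
    intro B hB
    rw [pmu_mul_prime P B hP (mem_sft.1 hB).1.1]
    split_ifs <;> simp_all
  · simp

lemma serN_step (S : Finset F[X]) (P : F[X]) (hP : P.Monic ∧ Irreducible P)
    (hS : ∀ Q ∈ S, Q.Monic ∧ Irreducible Q) (hPS : P ∉ S) :
    serN (insert P S) = serN S * (1 - PowerSeries.X ^ P.natDegree) := by
  ext k
  rw [mul_sub, mul_one, map_sub, PowerSeries.coeff_mul_X_pow']
  simp only [serN, PowerSeries.coeff_mk]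
  rw [split_gen (fun _ => 1) S P hP hS hPS k]
  ring

lemma serA_all (S : Finset F[X]) (hS : ∀ Q ∈ S, Q.Monic ∧ Irreducible Q) :
    serA (∅ : Finset F[X]) = serA S * serE S := by
  induction S using Finset.induction_on with
  | empty => simp [serE]
  | insert P S hPS ih =>
    rw [ih (fun Q hQ => hS Q (by simp [hQ])),
      serA_step S P (hS P (by simp)) (fun Q hQ => hS Q (by simp [hQ])) hPS]
    simp only [serE, Finset.prod_insert hPS]
    ring

lemma serN_all (S : Finset F[X]) (hS : ∀ Q ∈ S, Q.Monic ∧ Irreducible Q) :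
    serN S = serN (∅ : Finset F[X]) * serE S := by
  induction S using Finset.induction_on with
  | empty => simp [serE]
  | insert P S hPS ih =>
    rw [serN_step S P (hS P (by simp)) (fun Q hQ => hS Q (by simp [hQ])) hPS,
      ih (fun Q hQ => hS Q (by simp [hQ]))]
    simp only [serE, Finset.prod_insert hPS]
    ring

lemma serAN : serA (∅ : Finset F[X]) * serN (∅ : Finset F[X]) = 1 := by
  ext k
  set S : Finset F[X] := ((Finset.range (k+1)).biUnion (fun j => amon F j)).filter Irreducible
    with hSdef
  have hS : ∀ Q ∈ S, Q.Monic ∧ Irreducible Q := by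
    intro Q hQ
    simp only [hSdef, Finset.mem_filter, Finset.mem_biUnion, mem_amon] at hQ
    obtain ⟨⟨a, _, h⟩, h2⟩ := hQ
    exact ⟨h.1, h2⟩
  have e : serA (∅ : Finset F[X]) * serN (∅ : Finset F[X]) = serA S * serN S := by
    rw [serA_all S hS, serN_all S hS]; ring
  have hempty : ∀ j, j ≤ k → j ≠ 0 → sft S j = ∅ := by
    intro j hj hj0
    rw [Finset.eq_empty_iff_forall_notMem]
    intro A hA
    rw [mem_sft] at hA
    obtain ⟨⟨hm, hd⟩, hA⟩ := hA
    have hnu : ¬ IsUnit A := by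
      intro hu
      exact hj0 (hd ▸ natDegree_eq_zero_of_isUnit hu)
    obtain ⟨P, hPm, hPi, hPd⟩ := exists_monic_irreducible_factor A hnu
    refine hA P ?_ hPd
    simp only [hSdef, Finset.mem_filter, Finset.mem_biUnion, mem_amon, Finset.mem_range]
    refine ⟨⟨P.natDegree, ?_, hPm, rfl⟩, hPi⟩
    have := natDegree_le_of_dvd hPd hm.ne_zero
    omega
  have hzero : sft S 0 = {1} := by
    ext A
    rw [mem_sft, Finset.mem_singleton]
    constructor
    · rintro ⟨⟨h1, h2⟩, _⟩
      exact h1.natDegree_eq_zero.1 h2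
    · rintro rfl
      refine ⟨⟨monic_one, natDegree_one⟩, fun P hP hd => (hS P hP).2.not_isUnit
        (isUnit_of_dvd_one hd)⟩
  rw [e, PowerSeries.coeff_mul]
  rcases Nat.eq_zero_or_pos k with h0 | h0
  · subst h0
    simp [serA, serN, hzero, pmu]
  · rw [PowerSeries.coeff_one, if_neg h0.ne']
    apply Finset.sum_eq_zero
    rintro ⟨a, b⟩ hab
    rw [Finset.HasAntidiagonal.mem_antidiagonal] at hab
    simp only at hab
    simp only [serA, serN, PowerSeries.coeff_mk]
    by_cases ha : a = 0
    · rw [hempty b (by omega) (by omega)]; simp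
    · rw [hempty a (by omega) ha]; simp

lemma serA_empty : serA (∅ : Finset F[X]) =
    1 - PowerSeries.C (Fintype.card F : ℝ) * PowerSeries.X := by
  have hN : serN (∅ : Finset F[X]) * (1 - PowerSeries.C (Fintype.card F : ℝ) * PowerSeries.X) = 1 := by
    have : serN (∅ : Finset F[X]) = PowerSeries.mk (fun k => (Fintype.card F : ℝ) ^ k) := by
      ext k
      simp [serN, sft, card_amon]
    rw [this]
    ext k
    rw [mul_sub, mul_one, mul_left_comm, map_sub, PowerSeries.coeff_C_mul]
    cases k with
    | zero => simp
    | succ k =>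
      rw [PowerSeries.coeff_succ_mul_X]
      simp [PowerSeries.coeff_one, pow_succ]; ring
  calc serA (∅ : Finset F[X]) = serA (∅ : Finset F[X]) * (serN (∅ : Finset F[X]) * (1 - PowerSeries.C (Fintype.card F : ℝ) * PowerSeries.X)) := by rw [hN, mul_one]
    _ = _ := by rw [← mul_assoc, serAN, one_mul]

noncomputable def geo (n : ℕ) : PowerSeries ℝ := PowerSeries.mk fun j => if n ∣ j then 1 else 0

lemma geo_mul (n : ℕ) (hn : 0 < n) : geo n * (1 - PowerSeries.X ^ n) = 1 := by
  ext k
  rw [mul_sub, mul_one, map_sub, PowerSeries.coeff_mul_X_pow']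
  simp only [geo, PowerSeries.coeff_mk, PowerSeries.coeff_one]
  by_cases hk : n ≤ k
  · rw [if_pos hk, if_neg (show k ≠ 0 by omega)]
    have : n ∣ k - n ↔ n ∣ k := (Nat.dvd_sub_iff_left hk (dvd_refl n))
    simp only [this, sub_self]
  · rw [if_neg hk, sub_zero]
    congr 1
    rw [eq_iff_iff]
    constructor
    · intro h
      exact Nat.eq_zero_of_dvd_of_lt h (by omega)
    · rintro rfl; simp

lemma geo_hasSum (n : ℕ) (hn : 0 < n) (x : ℝ) (hx0 : 0 ≤ x) (hx1 : x < 1) :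
    HasSum (fun k => PowerSeries.coeff k (geo n) * x ^ k) (1 - x ^ n)⁻¹ := by
  have h1 : HasSum (fun j : ℕ => (x ^ n) ^ j) (1 - x ^ n)⁻¹ :=
    hasSum_geometric_of_lt_one (by positivity) (pow_lt_one₀ hx0 hx1 hn.ne')
  have inj : Function.Injective (fun j : ℕ => n * j) := fun a b h => Nat.eq_of_mul_eq_mul_left hn h
  rw [← inj.hasSum_iff]
  · convert h1 using 2 with j
    simp [geo, pow_mul]
  · intro k hk
    have : ¬ n ∣ k := by
      rintro ⟨c, rfl⟩; exact hk ⟨c, rfl⟩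
    simp [geo, this]

noncomputable def serG (S : Finset F[X]) : PowerSeries ℝ := ∏ P ∈ S, geo P.natDegree

lemma serG_hasSum (S : Finset F[X]) (hS : ∀ Q ∈ S, 0 < Q.natDegree) :
    (∀ k, 0 ≤ PowerSeries.coeff k (serG S)) ∧ ∀ x : ℝ, 0 ≤ x → x < 1 →
    HasSum (fun k => PowerSeries.coeff k (serG S) * x ^ k) (∏ P ∈ S, (1 - x ^ P.natDegree)⁻¹) := by
  induction S using Finset.induction_on with
  | empty =>
    constructor
    · intro k; simp only [serG, Finset.prod_empty, PowerSeries.coeff_one]; split_ifs <;> norm_num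
    · intro x _ _
      simp only [serG, Finset.prod_empty, PowerSeries.coeff_one]
      convert hasSum_ite_eq (0 : ℕ) (1 : ℝ) using 2 with k
      split_ifs with h <;> simp [h]
  | insert P S hPS ih =>
    obtain ⟨ih1, ih2⟩ := ih (fun Q hQ => hS Q (by simp [hQ]))
    have hn := hS P (by simp)
    have hg : ∀ k, 0 ≤ PowerSeries.coeff k (geo P.natDegree) := by
      intro k; simp only [geo, PowerSeries.coeff_mk]; split_ifs <;> norm_num
    simp only [serG, Finset.prod_insert hPS] at *
    constructor
    · intro k
      rw [PowerSeries.coeff_mul]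
      exact Finset.sum_nonneg fun _ _ => mul_nonneg (hg _) (ih1 _)
    · intro x hx0 hx1
      have a := geo_hasSum P.natDegree hn x hx0 hx1
      have b := ih2 x hx0 hx1
      have a' : Summable (fun k => ‖PowerSeries.coeff k (geo P.natDegree) * x ^ k‖) :=
        a.summable.norm
      have b' := b.summable.norm
      rw [← a.tsum_eq, ← b.tsum_eq,
        tsum_mul_tsum_eq_tsum_sum_antidiagonal_of_summable_norm a' b']
      have hh := (summable_norm_sum_mul_antidiagonal_of_summable_norm a' b').of_norm.hasSum
      refine Eq.subst (motive := fun f => HasSum f _) (funext fun k => ?_) hh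
      symm
      rw [PowerSeries.coeff_mul, Finset.sum_mul]
      apply Finset.sum_congr rfl
      rintro ⟨i, j⟩ hij
      rw [Finset.HasAntidiagonal.mem_antidiagonal] at hij
      simp only at hij ⊢
      rw [← hij, pow_add]; ring

lemma serA_eq (S : Finset F[X]) (hS : ∀ Q ∈ S, Q.Monic ∧ Irreducible Q) :
    serA S = (1 - PowerSeries.C (Fintype.card F : ℝ) * PowerSeries.X) * serG S := by
  have h : serE S * serG S = 1 := by
    rw [serE, serG, ← Finset.prod_mul_distrib]
    apply Finset.prod_eq_one
    intro P hP
    rw [mul_comm]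
    exact geo_mul _ (hS P hP).2.natDegree_pos
  rw [← serA_empty, serA_all S hS, mul_assoc, h, mul_one]

lemma sum_ident (S : Finset F[X]) (hS : ∀ Q ∈ S, Q.Monic ∧ Irreducible Q) (q : ℝ) (hq0 : 0 < q)
    (hq : (Fintype.card F : ℝ) = q) (d : ℕ) :
    ∑ k ∈ Finset.Icc 1 d, (k : ℝ) * (q ^ k)⁻¹ * ∑ A ∈ sft S k, (pmu A : ℝ) =
    d * (PowerSeries.coeff d (serG S) * q⁻¹ ^ d) -
      ∑ k ∈ Finset.range d, PowerSeries.coeff k (serG S) * q⁻¹ ^ k := by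
  induction d with
  | zero => simp
  | succ d ih =>
    rw [Finset.sum_Icc_succ_top (by omega), ih, Finset.sum_range_succ]
    have h1 : ∑ A ∈ sft S (d+1), (pmu A : ℝ) = PowerSeries.coeff (d+1) (serG S) -
        q * PowerSeries.coeff d (serG S) := by
      have : ∑ A ∈ sft S (d+1), (pmu A : ℝ) = PowerSeries.coeff (d+1) (serA S) := by
        simp [serA]
      rw [this, serA_eq S hS, sub_mul, one_mul, map_sub, mul_assoc, PowerSeries.coeff_C_mul,
        PowerSeries.coeff_succ_X_mul, hq]
    rw [h1]
    push_cast
    simp only [inv_pow]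
    field_simp
    ring

lemma card_units_prime (P : F[X]) (hP : Irreducible P) :
    Nat.card (F[X] ⧸ Ideal.span {P})ˣ = Fintype.card F ^ P.natDegree - 1 := by
  have hmax : (Ideal.span {P}).IsMaximal := PrincipalIdealRing.isMaximal_of_irreducible hP
  let _ : Field (F[X] ⧸ Ideal.span {P}) := Ideal.Quotient.field _
  have h1 := finrank_quotient_span_eq_natDegree (f := P)
  have hfin : Module.Finite F (F[X] ⧸ Ideal.span {P}) :=
    Module.finite_of_finrank_pos (by rw [h1]; exact hP.natDegree_pos)
  rw [Nat.card_units, Module.natCard_eq_pow_finrank (K := F), h1, Nat.card_eq_fintype_card]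

lemma card_units_prod (S : Finset F[X]) (hS : ∀ Q ∈ S, Q.Monic ∧ Irreducible Q) :
    Nat.card (F[X] ⧸ Ideal.span {∏ P ∈ S, P})ˣ = ∏ P ∈ S, (Fintype.card F ^ P.natDegree - 1) := by
  induction S using Finset.induction_on with
  | empty =>
    have : Subsingleton (F[X] ⧸ Ideal.span {(1 : F[X])}) := by
      rw [Ideal.Quotient.subsingleton_iff]; simp
    rw [Finset.prod_empty, Finset.prod_empty]
    exact Nat.card_unique
  | insert P S hPS ih =>
    rw [Finset.prod_insert hPS, Finset.prod_insert hPS, ← ih (fun Q hQ => hS Q (by simp [hQ])),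
      ← card_units_prime P (hS P (by simp)).2, ← Nat.card_prod]
    have hc : IsCoprime P (∏ P ∈ S, P) := by
      apply IsCoprime.prod_right
      intro Q hQ
      rw [(hS P (by simp)).2.coprime_iff_not_dvd]
      intro hd
      have := (hS P (by simp)).2.associated_of_dvd (hS Q (by simp [hQ])).2 hd
      have := eq_of_monic_of_associated (hS P (by simp)).1 (hS Q (by simp [hQ])).1 this
      exact hPS (this ▸ hQ)
    rw [← Ideal.span_singleton_mul_span_singleton]
    have hc' := (Ideal.isCoprime_span_singleton_iff _ _).2 hc
    exact Nat.card_congr ((Units.mapEquiv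
      (Ideal.quotientMulEquivQuotientProd _ _ hc').toMulEquiv).trans MulEquiv.prodUnits).toEquiv

lemma main_term (S : Finset F[X]) (hS : ∀ Q ∈ S, Q.Monic ∧ Irreducible Q) (q : ℕ) (hq1 : 1 < q)
    (hq : Fintype.card F = q) :
    (q : ℝ) ^ (∏ P ∈ S, P).natDegree / (Nat.card (F[X] ⧸ Ideal.span {∏ P ∈ S, P})ˣ : ℝ) =
    ∏ P ∈ S, (1 - ((q : ℝ)⁻¹) ^ P.natDegree)⁻¹ := by
  rw [card_units_prod S hS, natDegree_prod_of_monic _ _ (fun P hP => (hS P hP).1),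
    ← Finset.prod_pow_eq_pow_sum, Nat.cast_prod, ← Finset.prod_div_distrib]
  apply Finset.prod_congr rfl
  intro P hP
  have : 1 < q ^ P.natDegree := one_lt_pow₀ hq1 (hS P hP).2.natDegree_pos.ne'
  rw [hq, Nat.cast_sub this.le]
  have h2 : (1 : ℝ) < (q : ℝ) ^ P.natDegree := by exact_mod_cast this
  have h3 : (q : ℝ) ^ P.natDegree - 1 ≠ 0 := by linarith
  push_cast
  rw [inv_pow]
  have : 1 - ((q : ℝ) ^ P.natDegree)⁻¹ = ((q : ℝ) ^ P.natDegree - 1) / (q : ℝ) ^ P.natDegree := by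
    field_simp
  rw [this, inv_div]

lemma rankin (y : ℝ) (hy0 : 0 < y) (hy1 : y < 1) : ∃ C : ℝ, 0 < C ∧ ∀ S : Finset F[X],
    (∀ Q ∈ S, Q.Monic ∧ Irreducible Q) →
    (∏ P ∈ S, (1 - y ^ P.natDegree)⁻¹) * y ^ (∏ P ∈ S, P).natDegree ≤ C := by
  obtain ⟨D, hD⟩ := exists_pow_lt_of_lt_one (show (0:ℝ) < 1/2 by norm_num) hy1
  set T : Finset F[X] := (Finset.range D).biUnion (fun j => amon F j) with hT
  set f : F[X] → ℝ := fun P => max 1 ((1 - y ^ P.natDegree)⁻¹ * y ^ P.natDegree) with hf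
  have hf1 : ∀ P, 1 ≤ f P := fun P => le_max_left _ _
  refine ⟨∏ P ∈ T, f P, Finset.prod_pos fun P _ => lt_of_lt_of_le one_pos (hf1 P), ?_⟩
  intro S hS
  rw [natDegree_prod_of_monic _ _ (fun P hP => (hS P hP).1),
    ← Finset.prod_pow_eq_pow_sum, ← Finset.prod_mul_distrib]
  have hout : ∀ P ∈ S ∪ T, P ∉ T → f P = 1 := by
    intro P hP hPT
    have hPS : P ∈ S := by
      rcases Finset.mem_union.1 hP with h | h
      · exact h
      · exact absurd h hPT
    have hdeg : D ≤ P.natDegree := by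
      by_contra hlt
      apply hPT
      simp only [hT, Finset.mem_biUnion, Finset.mem_range, mem_amon]
      exact ⟨P.natDegree, by omega, (hS P hPS).1, rfl⟩
    have h2 : y ^ P.natDegree ≤ 1/2 := (pow_le_pow_of_le_one hy0.le hy1.le hdeg).trans hD.le
    simp only [hf]
    apply max_eq_left
    rw [inv_mul_le_iff₀ (by linarith)]
    linarith
  calc _ ≤ ∏ P ∈ S, f P := by
        apply Finset.prod_le_prod
        · intro P hP
          have : y ^ P.natDegree ≤ 1 := pow_le_one₀ hy0.le hy1.le
          have : 0 ≤ 1 - y ^ P.natDegree := by linarith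
          positivity
        · intro P hP; exact le_max_right _ _
    _ ≤ ∏ P ∈ S ∪ T, f P := by
        rw [← Finset.prod_sdiff (Finset.subset_union_left : S ⊆ S ∪ T)]
        exact le_mul_of_one_le_left
          (Finset.prod_nonneg fun P _ => zero_le_one.trans (hf1 P))
          (Finset.one_le_prod fun P _ => hf1 P)
    _ = ∏ P ∈ T, f P := (Finset.prod_subset Finset.subset_union_right hout).symm

lemma coprime_iff (S : Finset F[X]) (hS : ∀ Q ∈ S, Q.Monic ∧ Irreducible Q) (A : F[X]) :
    IsCoprime A (∏ P ∈ S, P) ↔ ∀ P ∈ S, ¬ P ∣ A := by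
  rw [IsCoprime.prod_right_iff]
  refine forall₂_congr fun P hP => ?_
  rw [isCoprime_comm, (hS P hP).2.coprime_iff_not_dvd]

lemma exists_S (M : F[X]) (hM : M.Monic) (hsq : Squarefree M) : ∃ S : Finset F[X],
    (∀ Q ∈ S, Q.Monic ∧ Irreducible Q) ∧ M = ∏ P ∈ S, P := by
  have hnd := (UniqueFactorizationMonoid.squarefree_iff_nodup_normalizedFactors hM.ne_zero).1 hsq
  have hS : ∀ Q ∈ (UniqueFactorizationMonoid.normalizedFactors M).toFinset,
      Q.Monic ∧ Irreducible Q := by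
    intro Q hQ
    rw [Multiset.mem_toFinset] at hQ
    have hi := UniqueFactorizationMonoid.irreducible_of_normalized_factor Q hQ
    refine ⟨?_, hi⟩
    rw [← UniqueFactorizationMonoid.normalize_normalized_factor Q hQ]
    exact monic_normalize hi.ne_zero
  refine ⟨(UniqueFactorizationMonoid.normalizedFactors M).toFinset, hS, ?_⟩
  apply eq_of_monic_of_associated hM (monic_prod_of_monic _ _ fun P hP => (hS P hP).1)
  have h := UniqueFactorizationMonoid.prod_normalizedFactors hM.ne_zero
  rw [Finset.prod, Multiset.toFinset_val, hnd.dedup, Multiset.map_id']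
  exact h.symm

end aux
/-- analytic final step -/
lemma final_bound (r y : ℝ) (hr0 : 0 < r) (hry : r < y) (hy1 : y < 1) (C : ℝ) (hC : 0 < C) :
    ∃ C' : ℝ, 0 < C' ∧ ∀ (g : ℕ → ℝ) (m : ℕ) (G H : ℝ), (∀ k, 0 ≤ g k) →
      HasSum (fun k => g k * y ^ k) G → HasSum (fun k => g k * r ^ k) H → G * y ^ m ≤ C →
      ∀ d : ℕ, |(d * (g d * r ^ d) - ∑ k ∈ Finset.range d, g k * r ^ k) + H|
        ≤ C' * (r ^ d * (y⁻¹ ^ 2) ^ (m + d)) := by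
  have hy0 : 0 < y := hr0.trans hry
  set s := r / y with hs
  have hs0 : 0 < s := div_pos hr0 hy0
  have hs1 : s < 1 := (div_lt_one hy0).2 hry
  set b := y⁻¹ - 1 with hb
  have hyi : 1 < y⁻¹ := (one_lt_inv₀ hy0).2 hy1
  have hb0 : 0 < b := by linarith
  have hK : 0 < (1 - s)⁻¹ := inv_pos.2 (by linarith)
  refine ⟨C * (b⁻¹ + (1 - s)⁻¹), by positivity, ?_⟩
  intro g m G H hg hG hH hGC d
  have hgk : ∀ k, g k * r ^ k ≤ C * y⁻¹ ^ m * s ^ k := by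
    intro k
    have h1 : g k * y ^ k ≤ G := le_hasSum hG k (fun j _ => mul_nonneg (hg j) (by positivity))
    have h2 : g k * y ^ k * y ^ m ≤ C := (mul_le_mul_of_nonneg_right h1 (by positivity)).trans hGC
    have h3 : g k * r ^ k = (g k * y ^ k * y ^ m) * (y⁻¹ ^ m * s ^ k) := by
      rw [hs, div_pow, inv_pow]; field_simp
    rw [h3, mul_assoc C]
    exact mul_le_mul_of_nonneg_right h2 (by positivity)
  have htail : H - ∑ k ∈ Finset.range d, g k * r ^ k = ∑' k, g (k + d) * r ^ (k + d) := by
    rw [← hH.tsum_eq, ← hH.summable.sum_add_tsum_nat_add d]; ring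
  have hsum2 : Summable (fun k => g (k + d) * r ^ (k + d)) :=
    (summable_nat_add_iff (f := fun k => g k * r ^ k) d).2 hH.summable
  have hgeo : HasSum (fun k => C * y⁻¹ ^ m * s ^ d * s ^ k) (C * y⁻¹ ^ m * s ^ d * (1 - s)⁻¹) :=
    (hasSum_geometric_of_lt_one hs0.le hs1).mul_left _
  have htb : ∑' k, g (k + d) * r ^ (k + d) ≤ C * y⁻¹ ^ m * s ^ d * (1 - s)⁻¹ := by
    rw [← hgeo.tsum_eq]
    apply hsum2.tsum_le_tsum _ hgeo.summable
    intro k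
    refine (hgk (k + d)).trans (le_of_eq ?_)
    rw [pow_add]; ring
  have htn : 0 ≤ ∑' k, g (k + d) * r ^ (k + d) :=
    tsum_nonneg fun k => mul_nonneg (hg _) (by positivity)
  have e : (d * (g d * r ^ d) - ∑ k ∈ Finset.range d, g k * r ^ k) + H =
    d * (g d * r ^ d) + ∑' k, g (k + d) * r ^ (k + d) := by rw [← htail]; ring
  rw [e, abs_of_nonneg (add_nonneg (mul_nonneg (by positivity) (mul_nonneg (hg _) (by positivity))) htn)]
  have hbern : 1 + (d : ℝ) * b ≤ y⁻¹ ^ d := by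
    have := one_add_mul_le_pow (a := b) (by linarith) d
    rwa [show 1 + b = y⁻¹ by rw [hb]; ring] at this
  have hd : (d : ℝ) ≤ b⁻¹ * y⁻¹ ^ d := by
    rw [inv_mul_eq_div, le_div_iff₀ hb0]; linarith
  have h1 : (1 : ℝ) ≤ y⁻¹ ^ d := one_le_pow₀ hyi.le
  have h1m : (1 : ℝ) ≤ y⁻¹ ^ m := one_le_pow₀ hyi.le
  have hX : 0 < C * y⁻¹ ^ m * s ^ d := by positivity
  calc _ ≤ d * (C * y⁻¹ ^ m * s ^ d) + C * y⁻¹ ^ m * s ^ d * (1 - s)⁻¹ :=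
        add_le_add (mul_le_mul_of_nonneg_left (hgk d) (by positivity)) htb
    _ = (C * y⁻¹ ^ m * s ^ d) * (d + (1 - s)⁻¹) := by ring
    _ ≤ (C * y⁻¹ ^ m * s ^ d) * (b⁻¹ * y⁻¹ ^ d + (1 - s)⁻¹ * y⁻¹ ^ d) := by
        apply mul_le_mul_of_nonneg_left _ hX.le
        exact add_le_add hd (le_mul_of_one_le_right hK.le h1)
    _ = C * (b⁻¹ + (1 - s)⁻¹) * (r ^ d * (y⁻¹ ^ m * (y⁻¹ ^ 2) ^ d)) := by
        rw [hs, div_eq_mul_inv, mul_pow, ← pow_mul, mul_comm 2 d, pow_mul]; ring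
    _ ≤ _ := by
        have : 0 < C * (b⁻¹ + (1 - s)⁻¹) := by positivity
        apply mul_le_mul_of_nonneg_left _ this.le
        apply mul_le_mul_of_nonneg_left _ (by positivity)
        rw [pow_add]
        apply mul_le_mul_of_nonneg_right _ (by positivity)
        rw [← pow_mul, mul_comm 2 m, pow_mul, sq]
        exact le_mul_of_one_le_right (by positivity) h1m

theorem statement19 (q : ℕ) (hq : IsPrimePow q) (ε : ℝ) (hε : 0 < ε)
    (Fq : Type) [Field Fq] [Fintype Fq] (hcard : Fintype.card Fq = q) :
    ∃ C : ℝ, ∀ (d m : ℕ) (M : Polynomial Fq), M.Monic → Squarefree M → M.natDegree = m →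
      |(∑ k ∈ Finset.Icc 1 d, (k : ℝ) * ((q : ℝ) ^ k)⁻¹ *
            ∑ᶠ A ∈ {A : Polynomial Fq | A.Monic ∧ A.natDegree = k ∧ IsCoprime A M},
              (pmu A : ℝ))
          + (q : ℝ) ^ m / (Nat.card (Polynomial Fq ⧸ Ideal.span {M})ˣ : ℝ)|
        ≤ C * (q : ℝ) ^ (ε * ((m : ℝ) + (d : ℝ)) - (d : ℝ)) := by
  have hq1 : 1 < q := hq.one_lt
  have hqr : (1 : ℝ) < q := by exact_mod_cast hq1
  have hq0 : (0 : ℝ) < q := by linarith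
  set δ : ℝ := min (ε / 2) (1 / 2) with hδ
  have hδ0 : 0 < δ := lt_min (by linarith) (by norm_num)
  have hδ1 : δ ≤ 1 / 2 := min_le_right _ _
  have hδε : 2 * δ ≤ ε := by have := min_le_left (ε / 2) (1 / 2 : ℝ); linarith
  set y : ℝ := (q : ℝ) ^ (-δ) with hy
  have hy0 : 0 < y := Real.rpow_pos_of_pos hq0 _
  have hy1 : y < 1 := Real.rpow_lt_one_of_one_lt_of_neg hqr (by linarith)
  have hry : (q : ℝ)⁻¹ < y := by
    rw [hy, ← Real.rpow_neg_one]
    exact Real.rpow_lt_rpow_of_exponent_lt hqr (by linarith)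
  obtain ⟨C, hC, hR⟩ := rankin (F := Fq) y hy0 hy1
  obtain ⟨C', hC', hB⟩ := final_bound (q : ℝ)⁻¹ y (inv_pos.2 hq0) hry hy1 C hC
  refine ⟨C', ?_⟩
  rintro d m M hM hsq rfl
  obtain ⟨S, hS, rfl⟩ := exists_S M hM hsq
  have hpos : ∀ Q ∈ S, 0 < Q.natDegree := fun Q hQ => (hS Q hQ).2.natDegree_pos
  obtain ⟨hg, hsum⟩ := serG_hasSum S hpos
  have key := hB (fun k => PowerSeries.coeff k (serG S)) (∏ P ∈ S, P).natDegree _ _ hg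
    (hsum y hy0.le hy1) (hsum (q : ℝ)⁻¹ (inv_pos.2 hq0).le (hry.trans hy1)) (hR S hS) d
  have hfs : ∀ k, ∑ᶠ A ∈ {A : Polynomial Fq | A.Monic ∧ A.natDegree = k ∧
      IsCoprime A (∏ P ∈ S, P)}, (pmu A : ℝ) = ∑ A ∈ sft S k, (pmu A : ℝ) := by
    intro k
    rw [← finsum_mem_coe_finset]
    congr 1
    ext A
    have : A ∈ {A : Polynomial Fq | A.Monic ∧ A.natDegree = k ∧
      IsCoprime A (∏ P ∈ S, P)} ↔ A ∈ (sft S k : Set Fq[X]) := by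
      simp only [Set.mem_ofPred_eq, Finset.mem_coe, mem_sft, coprime_iff S hS, and_assoc]
    simp only [this]
  simp only [hfs]
  rw [sum_ident S hS q hq0 (by exact_mod_cast hcard) d, main_term S hS q hq1 hcard]
  refine key.trans (mul_le_mul_of_nonneg_left ?_ hC'.le)
  have e1 : (q : ℝ)⁻¹ ^ d = (q : ℝ) ^ (-(d : ℝ)) := by
    rw [Real.rpow_neg hq0.le, Real.rpow_natCast, inv_pow]
  have e2 : (y⁻¹ ^ 2) = (q : ℝ) ^ (2 * δ) := by
    rw [hy, Real.rpow_neg hq0.le, inv_inv, mul_comm, Real.rpow_mul hq0.le]; norm_cast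
  rw [e1, e2, ← Real.rpow_natCast, ← Real.rpow_mul hq0.le, ← Real.rpow_add hq0]
  apply Real.rpow_le_rpow_of_exponent_le hqr.le
  push_cast
  have : (0 : ℝ) ≤ ((∏ P ∈ S, P).natDegree : ℝ) + d := by positivity
  nlinarith
end
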